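/- arXiv:2304.11644 — 8 statements merged into one kernel-verified Lean document; each statement's English description precedes it below -/
import Mathlib

section
/- Let A be a C*-algebra, let B ⊆ A be a C*-subalgebra that is soft (as a C*-algebra in its own right), and let p ∈ B be a projection (p = p* = p²). Then the annihilator Ann_A(p) = {x ∈ A : xp = px = 0} is full in A, i.e. the closed two-sided ideal of A generated by Ann_A(p) is all of A. -/
/-!
Common definitions: softness for (non-unital) C*-algebras.

A C*-algebra is *soft* if it has no nonzero unital quotient; equivalently, for every
closed two-sided ideal `I` with `A/I ≠ 0`, the quotient `A/I` is not unital.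
We encode properties of the quotient `A/I` intrinsically in `A`.
-/

variable {A : Type*}

/-- The quotient of `A` by the two-sided ideal `I` is unital: some `e ∈ A` represents
a multiplicative unit of `A/I`. -/
def QuotUnital [NonUnitalNonAssocRing A] (I : TwoSidedIdeal A) : Prop :=
  ∃ e : A, ∀ x : A, x * e - x ∈ I ∧ e * x - x ∈ I

/-- The quotient of `A` by the two-sided ideal `I` is nonzero. -/
def QuotNonzero [NonUnitalNonAssocRing A] (I : TwoSidedIdeal A) : Prop :=
  ∃ x : A, x ∉ I

/-- A C*-algebra is *soft* if it has no nonzero unital quotient. -/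
def IsSoftCStar (A : Type*) [NonUnitalNonAssocRing A] [TopologicalSpace A] : Prop :=
  ∀ I : TwoSidedIdeal A, IsClosed (I : Set A) → QuotNonzero I → ¬ QuotUnital I

/-- A subset of `A` is *full* if the closed two-sided ideal it generates is all of `A`. -/
def IsFullSet [NonUnitalNonAssocRing A] [TopologicalSpace A] (S : Set A) : Prop :=
  ∀ I : TwoSidedIdeal A, IsClosed (I : Set A) → S ⊆ (I : Set A) → ∀ x : A, x ∈ I

/-- If `p` is an idempotent, then `p` represents a unit of `A` modulo any closed ideal containing
the annihilator of `p`. -/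
lemma mul_sub_mem_of_annihilator_subset [NonUnitalCStarAlgebra A] {p : A} (hp : p * p = p)
    {I : TwoSidedIdeal A} (hI : IsClosed (I : Set A))
    (hann : {x : A | x * p = 0 ∧ p * x = 0} ⊆ (I : Set A)) (y : A) :
    y * p - y ∈ I ∧ p * y - y ∈ I := by
  let _ := CStarAlgebra.spectralOrder A
  have _ := CStarAlgebra.spectralOrderedRing A
  have happ := (CStarAlgebra.increasingApproximateUnit A).toIsApproximateUnit
  have hright : ∀ x : A, x * p * p = x * p := fun x ↦ by rw [mul_assoc, hp]
  have hleft : ∀ x : A, p * (p * x) = p * x := fun x ↦ by rw [← mul_assoc, hp]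
  have hcorner : ∀ e : A, e - p * e - e * p + p * e * p ∈ I := fun e ↦ hann <| by
    constructor
    · simp [sub_mul, add_mul, hright]
    · simp [mul_sub, mul_add, hleft, mul_assoc]
  constructor
  · have hlim := happ.tendsto_mul_left (y * p - y)
    have hlim' := hlim.sub (hlim.mul_const p)
    rw [show y * p - y - (y * p - y) * p = y * p - y by simp [sub_mul, hright]] at hlim'
    refine hI.mem_of_tendsto hlim' (Filter.Eventually.of_forall fun e ↦ ?_)
    have heq : (y * p - y) * e - (y * p - y) * e * p =
        -y * (e - p * e - e * p + p * e * p) := by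
      noncomm_ring
    rw [SetLike.mem_coe, heq]
    exact I.mul_mem_left _ _ (hcorner e)
  · have hlim := happ.tendsto_mul_right (p * y - y)
    have hlim' := hlim.sub (hlim.const_mul p)
    rw [show p * y - y - p * (p * y - y) = p * y - y by simp [mul_sub, hleft]] at hlim'
    refine hI.mem_of_tendsto hlim' (Filter.Eventually.of_forall fun e ↦ ?_)
    have heq : e * (p * y - y) - p * (e * (p * y - y)) =
        (e - p * e - e * p + p * e * p) * -y := by
      noncomm_ring
    rw [SetLike.mem_coe, heq]
    exact I.mul_mem_right _ _ (hcorner e)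

/-- If `B ⊆ A` is a soft C*-subalgebra and `p ∈ B` is a projection,
then the annihilator `Ann_A(p) = {x : x p = p x = 0}` is full in `A`. -/
theorem annihilator_of_projection_full [NonUnitalCStarAlgebra A]
    (B : NonUnitalStarSubalgebra ℂ A) (hBclosed : IsClosed (B : Set A))
    (hBsoft : IsSoftCStar B)
    (p : A) (hpB : p ∈ B) (hp_star : star p = p) (hp_idem : p * p = p) :
    IsFullSet {x : A | x * p = 0 ∧ p * x = 0} := by
  intro I hI hann x
  have hunit := mul_sub_mem_of_annihilator_subset hp_idem hI hann
  let J : TwoSidedIdeal B := I.comap (NonUnitalStarSubalgebraClass.subtype B)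
  have hJ : ∀ b : B, b ∈ J ↔ (b : A) ∈ I := fun b ↦ TwoSidedIdeal.mem_comap _
  have hJclosed : IsClosed (J : Set B) := by
    convert hI.preimage continuous_subtype_val using 1
    ext b
    exact hJ b
  have hpI : p ∈ I := by
    by_contra hpI
    exact hBsoft J hJclosed ⟨⟨p, hpB⟩, fun h ↦ hpI ((hJ _).1 h)⟩
      ⟨⟨p, hpB⟩, fun b ↦ ⟨(hJ _).2 (hunit b).1, (hJ _).2 (hunit b).2⟩⟩
  have hx : x = x * p - (x * p - x) := by abel
  rw [hx]
  exact I.sub_mem (I.mul_mem_left _ _ hpI) (hunit x).1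
end

section
/- Let A be a C*-algebra, let B ⊆ A be a C*-subalgebra that is soft, and let a ∈ B₊ be a positive element such that a = ab for some positive b ∈ B₊. Then the annihilator Ann_A(a) = {x ∈ A : xa = ax = 0} is full in A, i.e. the closed two-sided ideal of A generated by Ann_A(a) equals A. -/
/-!
Common definitions: softness for (non-unital) C*-algebras.

A C*-algebra is *soft* if it has no nonzero unital quotient; equivalently, for every
closed two-sided ideal `I` with `A/I ≠ 0`, the quotient `A/I` is not unital.
We encode properties of the quotient `A/I` intrinsically in `A`.
-/

variable {A : Type*}

/-- A closed two-sided ideal of a C*-algebra contains every `z` for which it contains `z⋆z`. -/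
theorem TwoSidedIdeal.mem_of_star_mul_self_mem [NonUnitalCStarAlgebra A] (I : TwoSidedIdeal A)
    (hI : IsClosed (I : Set A)) {z : A} (hz : star z * z ∈ I) : z ∈ I := by
  rw [← SetLike.mem_coe, ← hI.closure_eq, Metric.mem_closure_iff]
  intro ε hε
  obtain ⟨c, hc, hcε⟩ : ∃ c : ℝ, 0 < c ∧ c < ε ^ 2 :=
    ⟨ε ^ 2 / 2, by positivity, by linarith [pow_pos hε 2]⟩
  set h := star z * z with h_def
  have hsa : IsSelfAdjoint h := .star_mul_self z
  have hpos (t : ℝ) : 0 < c ^ 2 + t ^ 2 := by positivity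
  have hne (t : ℝ) : c ^ 2 + t ^ 2 ≠ 0 := (hpos t).ne'
  let g : ℝ → ℝ := fun t => t / (c ^ 2 + t ^ 2)
  let f : ℝ → ℝ := fun t => t * g t
  have hg : Continuous g := by fun_prop (disch := exact hne _)
  have hf : Continuous f := by fun_prop
  have hg0 : g 0 = 0 := by simp [g]
  have hf0 : f 0 = 0 := by simp [f]
  have he : cfcₙ f h = h * cfcₙ g h := by
    rw [cfcₙ_mul (fun t => t) g h, cfcₙ_id' ℝ h]
  have hke : h - h * cfcₙ f h = cfcₙ (fun t => t - t * f t) h := by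
    rw [cfcₙ_sub (fun t => t) (fun t => t * f t) h, cfcₙ_mul (fun t => t) f h, cfcₙ_id' ℝ h]
  have hk : star (z - z * cfcₙ f h) * (z - z * cfcₙ f h) =
      cfcₙ (fun t => (t - t * f t) - f t * (t - t * f t)) h := by
    rw [cfcₙ_sub (fun t => t - t * f t) (fun t => f t * (t - t * f t)) h,
      cfcₙ_mul f (fun t => t - t * f t) h, ← hke, star_sub, star_mul,
      (cfcₙ_predicate f h : IsSelfAdjoint _).star_eq, h_def]
    noncomm_ring
  refine ⟨z * cfcₙ f h, I.mul_mem_left _ _ (he ▸ I.mul_mem_right _ _ hz), ?_⟩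
  have hle : ‖z - z * cfcₙ f h‖ * ‖z - z * cfcₙ f h‖ ≤ c := by
    rw [← CStarRing.norm_star_mul_self, hk]
    refine norm_cfcₙ_le fun t _ => ?_
    have hfun : (t - t * f t) - f t * (t - t * f t) =
        t * c ^ 2 / (c ^ 2 + t ^ 2) * (c ^ 2 / (c ^ 2 + t ^ 2)) := by
      have := hne t
      simp only [f, g]
      field_simp
      ring
    rw [hfun, norm_mul]
    refine (mul_le_mul ?_ ?_ (norm_nonneg _) hc.le).trans_eq (mul_one c)
    · rw [Real.norm_eq_abs, abs_div, abs_of_pos (hpos t), div_le_iff₀ (hpos t), abs_mul,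
        abs_of_pos (pow_pos hc 2)]
      nlinarith [sq_nonneg (c - |t|), sq_abs t, abs_nonneg t,
        mul_nonneg hc.le (add_nonneg (sq_nonneg (c - |t|)) (mul_nonneg hc.le (abs_nonneg t)))]
    · rw [Real.norm_of_nonneg (by positivity), div_le_one (hpos t)]
      linarith [sq_nonneg t]
  rw [dist_eq_norm]
  exact lt_of_pow_lt_pow_left₀ 2 hε.le (by rw [sq]; exact hle.trans_lt hcε)

/-- If `B ⊆ A` is a soft C*-subalgebra and `a ∈ B₊` satisfies `a = a b`
for some positive `b ∈ B₊`, then `Ann_A(a)` is full in `A`. -/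
theorem annihilator_full_of_soft_subalgebra [NonUnitalCStarAlgebra A]
    [PartialOrder A] [StarOrderedRing A]
    (B : NonUnitalStarSubalgebra ℂ A) (hBclosed : IsClosed (B : Set A))
    (hBsoft : IsSoftCStar B)
    (a : A) (haB : a ∈ B) (ha : 0 ≤ a)
    (hab : ∃ b ∈ B, 0 ≤ b ∧ a = a * b) :
    IsFullSet {x : A | x * a = 0 ∧ a * x = 0} := by
  obtain ⟨b, hbB, hb, hab⟩ := hab
  have hbs : star b = b := (IsSelfAdjoint.of_nonneg hb).star_eq
  have hba : a = b * a := by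
    simpa [hbs, (IsSelfAdjoint.of_nonneg ha).star_eq] using congrArg star hab
  intro I hI hS
  have hcorner (x : A) : (x - b * x) - (x - b * x) * b ∈ I := by
    refine hS ⟨?_, ?_⟩
    · rw [sub_mul, mul_assoc _ b a, ← hba, sub_self]
    · rw [mul_sub, ← mul_assoc, mul_sub, ← mul_assoc, ← hab, sub_self, zero_mul, sub_self]
  have hright (x : A) : x - x * b ∈ I := by
    refine I.mem_of_star_mul_self_mem hI ?_
    convert hcorner (star x * x) using 1
    rw [star_sub, star_mul, hbs]
    noncomm_ring
  have hleft (x : A) : x - b * x ∈ I := by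
    refine I.mem_of_star_mul_self_mem hI ?_
    rw [star_sub, star_mul, hbs]
    exact I.mul_mem_right _ _ (hright (star x))
  have hbI : b ∈ I := by
    by_contra hbI
    let J : TwoSidedIdeal B := I.comap (NonUnitalStarSubalgebraClass.subtype B)
    have hJ (x : B) : x ∈ J ↔ (x : A) ∈ I := TwoSidedIdeal.mem_comap _
    refine hBsoft J ?_ ⟨⟨b, hbB⟩, fun h => hbI ((hJ _).1 h)⟩ ⟨⟨b, hbB⟩, fun x => ⟨?_, ?_⟩⟩
    · convert hI.preimage (continuous_subtype_val (p := (· ∈ B))) using 1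
      ext x
      exact hJ x
    · rw [hJ, ← neg_sub]
      exact I.neg_mem (hright x)
    · rw [hJ, ← neg_sub]
      exact I.neg_mem (hleft x)
  intro x
  simpa using I.add_mem (hright x) (I.mul_mem_left x b hbI)
end

section
/- For a C*-algebra A the following are equivalent: (1) A is soft; (2) for every a ∈ Aᶜ, the annihilator Ann(a) is full in A; (3) for every a ∈ Aᶜ there exists b ∈ A₊ with a ⊥ b and a ◁ b; (4) for every a ∈ A₊ and every ε > 0 there exist b, c ∈ A₊ with ‖a − b‖ < ε, b ⊥ c, and b ◁ c. -/
/-!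
Common definitions: softness for (non-unital) C*-algebras.

A C*-algebra is *soft* if it has no nonzero unital quotient; equivalently, for every
closed two-sided ideal `I` with `A/I ≠ 0`, the quotient `A/I` is not unital.
We encode properties of the quotient `A/I` intrinsically in `A`.
-/

variable {A : Type*}

/-- `a ◁ b` : `a` belongs to the closed two-sided ideal generated by `b`. -/
def Lhd [NonUnitalNonAssocRing A] [TopologicalSpace A] (a b : A) : Prop :=
  ∀ I : TwoSidedIdeal A, IsClosed (I : Set A) → b ∈ I → a ∈ I

/-- If `y - f y` lies in a closed two-sided ideal preserved by the strictly contractive additive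
map `f`, then so does `y`. -/
lemma TwoSidedIdeal.mem_of_sub_map_mem [NonUnitalSeminormedRing A] {I : TwoSidedIdeal A}
    (hI : IsClosed (I : Set A)) (f : A →+ A) (hf : ∀ y ∈ I, f y ∈ I) {k : ℝ} (hk : k < 1)
    (hfk : ∀ y, ‖f y‖ ≤ k * ‖y‖) {x : A} (hx : x - f x ∈ I) : x ∈ I := by
  have hne : (I : Set A).Nonempty := ⟨0, I.zero_mem⟩
  have key : ∀ y ∈ I, Metric.infDist x I ≤ k * dist x y := fun y hy ↦ by
    have hmem : x - f x + f y ∈ I := I.add_mem hx (hf y hy)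
    calc Metric.infDist x I ≤ dist x (x - f x + f y) := Metric.infDist_le_dist_of_mem hmem
      _ = ‖f (x - y)‖ := by rw [dist_eq_norm, map_sub]; congr 1; abel
      _ ≤ k * dist x y := by rw [dist_eq_norm]; exact hfk _
  have hx' : x ∈ closure (I : Set A) := by
    refine Metric.mem_closure_iff.2 fun ε hε ↦ ?_
    by_contra! h
    have h0 : ε ≤ Metric.infDist x I := (Metric.le_infDist hne).2 fun {y} hy ↦ h y hy
    rcases le_or_gt k 0 with hk0 | hk0
    · have := key 0 I.zero_mem
      nlinarith [dist_nonneg (x := x) (y := 0)]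
    · have : Metric.infDist x I / k ≤ Metric.infDist x I :=
        (Metric.le_infDist hne).2 fun {y} hy ↦ by
          rw [div_le_iff₀' hk0]; exact key y hy
      rw [div_le_iff₀' hk0] at this
      nlinarith
  rwa [hI.closure_eq] at hx'

lemma TwoSidedIdeal.mem_of_sub_mul_mem [NonUnitalSeminormedRing A] {I : TwoSidedIdeal A}
    (hI : IsClosed (I : Set A)) {r x : A} (hr : ‖r‖ < 1) (hx : x - x * r ∈ I) : x ∈ I :=
  I.mem_of_sub_map_mem hI (AddMonoidHom.mulRight r) (fun _ hy ↦ I.mul_mem_right _ _ hy) hr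
    (fun y ↦ (norm_mul_le y r).trans_eq (mul_comm _ _)) hx

lemma TwoSidedIdeal.mem_of_sub_mul_mem' [NonUnitalSeminormedRing A] {I : TwoSidedIdeal A}
    (hI : IsClosed (I : Set A)) {r x : A} (hr : ‖r‖ < 1) (hx : x - r * x ∈ I) : x ∈ I :=
  I.mem_of_sub_map_mem hI (AddMonoidHom.mulLeft r) (fun _ hy ↦ I.mul_mem_left _ _ hy) hr
    (fun y ↦ norm_mul_le r y) hx

/-- The topological closure of a two-sided ideal. -/
def TwoSidedIdeal.closure [NonUnitalNonAssocRing A] [TopologicalSpace A] [IsTopologicalRing A]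
    (I : TwoSidedIdeal A) : TwoSidedIdeal A :=
  .mk' (_root_.closure (I : Set A)) (subset_closure I.zero_mem)
    (fun hx hy ↦ map_mem_closure₂ continuous_add hx hy fun _ ha _ hb ↦ I.add_mem ha hb)
    (fun hx ↦ map_mem_closure continuous_neg hx fun _ ha ↦ I.neg_mem ha)
    (fun {x _} hy ↦ map_mem_closure (continuous_const_mul x) hy fun _ ha ↦ I.mul_mem_left _ _ ha)
    (fun {_ y} hx ↦ map_mem_closure (f := (· * y)) (continuous_mul_const y) hx
      fun _ ha ↦ I.mul_mem_right _ _ ha)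

lemma TwoSidedIdeal.coe_closure [NonUnitalNonAssocRing A] [TopologicalSpace A]
    [IsTopologicalRing A] (I : TwoSidedIdeal A) :
    (I.closure : Set A) = _root_.closure (I : Set A) :=
  TwoSidedIdeal.coe_mk' ..

section CStarAlgebra

variable [NonUnitalCStarAlgebra A] [PartialOrder A] [StarOrderedRing A]

/-- For `0 ≤ c`, the element `c` is almost annihilated by `1 - c * h` for a suitable `h`. -/
lemma exists_norm_conjugate_one_sub_mul_le {c : A} (hc : 0 ≤ c) {η : ℝ} (hη : 0 < η) :
    ∃ h : A, IsSelfAdjoint (c * h) ∧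
      ‖c - c * h * c - c * (c * h) + c * h * c * (c * h)‖ ≤ η := by
  have hsa : IsSelfAdjoint c := .of_nonneg hc
  have hpos : ∀ t : ℝ, t ^ 2 + η ^ 2 ≠ 0 := fun t ↦ by positivity
  have hcont : Continuous fun t : ℝ ↦ t / (t ^ 2 + η ^ 2) := by fun_prop (disch := exact hpos _)
  set g : ℝ → ℝ := fun t ↦ t / (t ^ 2 + η ^ 2) with hg
  have hg0 : g 0 = 0 := by simp [hg]
  have hf : c * cfcₙ g c = cfcₙ (fun t ↦ t * g t) c := by
    rw [cfcₙ_mul (fun t : ℝ ↦ t) g c, cfcₙ_id' ℝ c]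
  refine ⟨cfcₙ g c, hf ▸ cfcₙ_predicate _ c, ?_⟩
  have hcfc : c - c * cfcₙ g c * c - c * (c * cfcₙ g c) + c * cfcₙ g c * c * (c * cfcₙ g c)
      = cfcₙ (fun t ↦ t - t * g t * t - t * (t * g t) + t * g t * t * (t * g t)) c := by
    rw [cfcₙ_add (fun t ↦ t - t * g t * t - t * (t * g t)) (fun t ↦ t * g t * t * (t * g t)) c,
      cfcₙ_sub (fun t ↦ t - t * g t * t) (fun t ↦ t * (t * g t)) c,
      cfcₙ_sub (fun t ↦ t) (fun t ↦ t * g t * t) c,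
      cfcₙ_mul (fun t ↦ t * g t * t) (fun t ↦ t * g t) c,
      cfcₙ_mul (fun t ↦ t * g t) (fun t ↦ t) c,
      cfcₙ_mul (fun t ↦ t) (fun t ↦ t * g t) c, ← hf, cfcₙ_id' ℝ c]
  rw [hcfc]
  refine norm_cfcₙ_le fun t _ ↦ ?_
  have : t - t * g t * t - t * (t * g t) + t * g t * t * (t * g t)
      = t * η ^ 4 / (t ^ 2 + η ^ 2) ^ 2 := by
    simp only [hg]; field_simp [hpos t]; ring
  rw [this, Real.norm_eq_abs, abs_div, abs_of_pos (a := (t ^ 2 + η ^ 2) ^ 2) (by positivity),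
    div_le_iff₀ (by positivity), abs_mul, abs_of_pos (a := η ^ 4) (by positivity), ← sq_abs t]
  have h1 : |t| * η ≤ |t| ^ 2 + η ^ 2 := by nlinarith [sq_nonneg (|t| - η), sq_nonneg (|t| + η)]
  calc |t| * η ^ 4 = η * ((|t| * η) * η ^ 2) := by ring
    _ ≤ η * ((|t| ^ 2 + η ^ 2) * (|t| ^ 2 + η ^ 2)) := by
        gcongr; nlinarith [sq_nonneg |t|]
    _ = η * (|t| ^ 2 + η ^ 2) ^ 2 := by ring

/-- Closed two-sided ideals of C⋆-algebras are hereditary. -/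
lemma TwoSidedIdeal.mem_of_mul_star_le {I : TwoSidedIdeal A} (hI : IsClosed (I : Set A)) {y c : A}
    (hc : c ∈ I) (hyc : y * star y ≤ c) : y ∈ I := by
  have hc0 : 0 ≤ c := (mul_star_self_nonneg y).trans hyc
  suffices hy : y ∈ _root_.closure (I : Set A) by rwa [hI.closure_eq] at hy
  refine Metric.mem_closure_iff.2 fun ε hε ↦ ?_
  obtain ⟨h, hsa, hnorm⟩ :=
    exists_norm_conjugate_one_sub_mul_le hc0 (η := ε ^ 2 / 2) (by positivity)
  refine ⟨c * h * y, I.mul_mem_right _ _ (I.mul_mem_right _ _ hc), ?_⟩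
  set f := c * h
  have hexp : ∀ w : A, (w - f * w) * star (w - f * w)
      = w * star w - f * (w * star w) - w * star w * f + f * (w * star w) * f := fun w ↦ by
    simp only [star_sub, star_mul, hsa.star_eq, mul_sub, sub_mul, mul_assoc]
    abel
  obtain ⟨w, hw⟩ := CStarAlgebra.nonneg_iff_eq_mul_star_self.1 (sub_nonneg.2 hyc)
  have hle : (y - f * y) * star (y - f * y) ≤ c - f * c - c * f + f * c * f := by
    rw [← sub_nonneg]
    have : c - f * c - c * f + f * c * f - (y - f * y) * star (y - f * y)
        = (w - f * w) * star (w - f * w) := by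
      rw [hexp, hexp, ← hw]
      simp only [mul_sub, sub_mul, mul_assoc]
      abel
    rw [this]
    exact mul_star_self_nonneg _
  have := (CStarAlgebra.norm_le_norm_of_nonneg_of_le (mul_star_self_nonneg _) hle).trans hnorm
  rw [CStarRing.norm_self_mul_star] at this
  rw [dist_eq_norm]
  nlinarith [norm_nonneg (y - f * y)]

lemma TwoSidedIdeal.star_mem {I : TwoSidedIdeal A} (hI : IsClosed (I : Set A)) {y : A}
    (hy : y ∈ I) : star y ∈ I :=
  I.mem_of_mul_star_le hI (I.mul_mem_left _ _ hy) (by rw [star_star])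

lemma TwoSidedIdeal.mem_of_le {I : TwoSidedIdeal A} (hI : IsClosed (I : Set A)) {x y : A}
    (hx : 0 ≤ x) (hy : y ∈ I) (hxy : x ≤ y) : x ∈ I := by
  obtain ⟨w, rfl⟩ := CStarAlgebra.nonneg_iff_eq_mul_star_self.1 hx
  exact I.mul_mem_right _ _ (I.mem_of_mul_star_le hI hy hxy)

lemma mul_eq_of_eq_mul {a b : A} (ha : 0 ≤ a) (hb : 0 ≤ b) (hab : a = a * b) : b * a = a := by
  simpa [(IsSelfAdjoint.of_nonneg ha).star_eq, (IsSelfAdjoint.of_nonneg hb).star_eq]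
    using (congrArg star hab).symm

/-- In a soft C⋆-algebra, elements with a local unit have full annihilator. -/
lemma IsSoftCStar.isFullSet_annihilator (hA : IsSoftCStar A) {a b : A} (ha : 0 ≤ a) (hb : 0 ≤ b)
    (hab : a = a * b) : IsFullSet {x : A | x * a = 0 ∧ a * x = 0} := by
  intro I hI hle
  by_contra! hne
  have hba := mul_eq_of_eq_mul ha hb hab
  have hbs := (IsSelfAdjoint.of_nonneg hb).star_eq
  have hmem : ∀ x : A, b * x - x ∈ I := fun x ↦ by
    refine I.mem_of_mul_star_le hI (hle ⟨?_, ?_⟩) le_rfl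
    · simp [mul_assoc, sub_mul, hbs, hba]
    · rw [← mul_assoc, mul_sub, ← mul_assoc, ← hab, sub_self, zero_mul]
  refine hA I hI hne ⟨b, fun x ↦ ⟨?_, hmem x⟩⟩
  simpa [hbs] using I.star_mem hI (hmem (star x))

/-- The elements of `A` generated, as members of a closed two-sided ideal, by a single positive
element orthogonal to `a`. -/
def orthogonalLhdIdeal (a : A) : TwoSidedIdeal A :=
  .mk' {x | ∃ c : A, 0 ≤ c ∧ a * c = 0 ∧ Lhd x c}
    ⟨0, le_rfl, mul_zero a, fun I _ _ ↦ I.zero_mem⟩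
    (by
      rintro x y ⟨c, hc, hac, hx⟩ ⟨d, hd, had, hy⟩
      refine ⟨c + d, add_nonneg hc hd, by rw [mul_add, hac, had, add_zero], fun I hI h ↦ ?_⟩
      exact I.add_mem (hx I hI (I.mem_of_le hI hc h (le_add_of_nonneg_right hd)))
        (hy I hI (I.mem_of_le hI hd h (le_add_of_nonneg_left hc))))
    (fun ⟨c, hc, hac, hx⟩ ↦ ⟨c, hc, hac, fun I hI h ↦ I.neg_mem (hx I hI h)⟩)
    (fun ⟨c, hc, hac, hx⟩ ↦ ⟨c, hc, hac, fun I hI h ↦ I.mul_mem_left _ _ (hx I hI h)⟩)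
    (fun ⟨c, hc, hac, hx⟩ ↦ ⟨c, hc, hac, fun I hI h ↦ I.mul_mem_right _ _ (hx I hI h)⟩)

lemma mem_orthogonalLhdIdeal {a x : A} :
    x ∈ orthogonalLhdIdeal a ↔ ∃ c : A, 0 ≤ c ∧ a * c = 0 ∧ Lhd x c :=
  TwoSidedIdeal.mem_mk' ..

lemma exists_orthogonal_lhd_of_isFullSet {a b : A} (hab : a = a * b)
    (h : IsFullSet {x : A | x * a = 0 ∧ a * x = 0}) :
    ∃ c : A, 0 ≤ c ∧ a * c = 0 ∧ Lhd a c := by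
  have hsub : {x : A | x * a = 0 ∧ a * x = 0} ⊆ ((orthogonalLhdIdeal a).closure : Set A) := by
    rintro y ⟨-, hy⟩
    rw [TwoSidedIdeal.coe_closure]
    exact subset_closure (mem_orthogonalLhdIdeal.2 ⟨y * star y, mul_star_self_nonneg y,
      by rw [← mul_assoc, hy, zero_mul], fun I hI h ↦ I.mem_of_mul_star_le hI h le_rfl⟩)
  have hb : b ∈ ((orthogonalLhdIdeal a).closure : Set A) :=
    h _ (by rw [TwoSidedIdeal.coe_closure]; exact isClosed_closure) hsub b
  rw [TwoSidedIdeal.coe_closure] at hb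
  obtain ⟨s, hs, hbs⟩ := Metric.mem_closure_iff.1 hb 1 one_pos
  obtain ⟨c, hc, hac, hsc⟩ := mem_orthogonalLhdIdeal.1 hs
  refine ⟨c, hc, hac, fun I hI hcI ↦ I.mem_of_sub_mul_mem hI (r := b - s) ?_ ?_⟩
  · rwa [← dist_eq_norm]
  · rw [mul_sub, ← hab, sub_sub_cancel]
    exact I.mul_mem_left _ _ (hsc I hI hcI)

/-- Positive elements are approximated by positive elements having a positive local unit. -/
lemma exists_eq_mul_norm_sub_le {a : A} (ha : 0 ≤ a) {δ : ℝ} (hδ : 0 < δ) :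
    ∃ b : A, 0 ≤ b ∧ (∃ d : A, 0 ≤ d ∧ b = b * d) ∧ ‖a - b‖ ≤ δ := by
  have hsa : IsSelfAdjoint a := .of_nonneg ha
  have hf : Continuous fun t : ℝ ↦ max (t - δ) 0 := by fun_prop
  have hg : Continuous fun t : ℝ ↦ max (min (t / δ) 1) 0 := by fun_prop
  have hf0 : max (0 - δ) 0 = 0 := by simp [hδ.le]
  have hg0 : max (min (0 / δ) 1) 0 = 0 := by simp
  refine ⟨cfcₙ (fun t : ℝ ↦ max (t - δ) 0) a, cfcₙ_nonneg fun _ _ ↦ le_max_right _ _,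
    ⟨cfcₙ (fun t : ℝ ↦ max (min (t / δ) 1) 0) a, cfcₙ_nonneg fun _ _ ↦ le_max_right _ _, ?_⟩, ?_⟩
  · rw [← cfcₙ_mul (fun t : ℝ ↦ max (t - δ) 0) (fun t : ℝ ↦ max (min (t / δ) 1) 0) a]
    congr 1
    funext t
    rcases le_total t δ with h | h
    · simp [h]
    · rw [min_eq_right ((one_le_div hδ).2 h)]
      simp
  · nth_rewrite 1 [← cfcₙ_id' ℝ a]
    rw [← cfcₙ_sub (fun t : ℝ ↦ t) (fun t : ℝ ↦ max (t - δ) 0) a]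
    refine norm_cfcₙ_le fun t ht ↦ ?_
    have ht0 : 0 ≤ t := quasispectrum_nonneg_of_nonneg a ha t ht
    rw [Real.norm_eq_abs, abs_le]
    rcases le_total t δ with h | h
    · rw [max_eq_right (by linarith)]; constructor <;> linarith
    · rw [max_eq_left (by linarith)]; constructor <;> linarith

lemma isSoftCStar_of_exists_lhd_norm_lt_one
    (h : ∀ a : A, 0 ≤ a → ∃ b c : A, ‖a - b‖ < 1 ∧ b * c = 0 ∧ Lhd b c) : IsSoftCStar A := by
  rintro I hI ⟨x, hx⟩ ⟨e, he⟩
  refine hx ?_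
  have hr : ∀ x, x - x * star e ∈ I := fun x ↦ by
    simpa using I.star_mem hI (I.neg_mem (he (star x)).2)
  have hl : ∀ x, x - star e * x ∈ I := fun x ↦ by
    simpa using I.star_mem hI (I.neg_mem (he (star x)).1)
  have hr' : ∀ x, x - x * (star e * e) ∈ I := fun x ↦ by
    have := I.sub_mem (hr x) (he (x * star e)).1
    rwa [mul_assoc, sub_sub_sub_cancel_right] at this
  have hl' : ∀ x, x - star e * e * x ∈ I := fun x ↦ by
    have h3 := I.add_mem (I.neg_mem (he x).2) (hl (e * x))
    rwa [neg_sub, sub_add_sub_cancel, ← mul_assoc] at h3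
  obtain ⟨b, c, hab, hbc, hlhd⟩ := h (star e * e) (star_mul_self_nonneg e)
  have hcI : c ∈ I := I.mem_of_sub_mul_mem' hI hab <| by
    rw [sub_mul, hbc, sub_zero]
    exact hl' c
  have hbI : b ∈ I := hlhd I hI hcI
  refine I.mem_of_sub_mul_mem hI hab ?_
  rw [mul_sub, ← sub_add]
  exact I.add_mem (hr' x) (I.mul_mem_left _ _ hbI)

end CStarAlgebra

/-- Characterizations of softness of a C*-algebra `A`.
Here `a ∈ Aᶜ` means `0 ≤ a` and `a = a b` for some `0 ≤ b`. -/
theorem isSoftCStar_tfae [NonUnitalCStarAlgebra A] [PartialOrder A] [StarOrderedRing A] :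
    List.TFAE
      [ IsSoftCStar A,
        ∀ a : A, 0 ≤ a → (∃ b : A, 0 ≤ b ∧ a = a * b) →
          IsFullSet {x : A | x * a = 0 ∧ a * x = 0},
        ∀ a : A, 0 ≤ a → (∃ b : A, 0 ≤ b ∧ a = a * b) →
          ∃ c : A, 0 ≤ c ∧ a * c = 0 ∧ Lhd a c,
        ∀ a : A, 0 ≤ a → ∀ ε : ℝ, 0 < ε →
          ∃ b c : A, 0 ≤ b ∧ 0 ≤ c ∧ ‖a - b‖ < ε ∧ b * c = 0 ∧ Lhd b c ] := by
  tfae_have 1 → 2 := fun h a ha ⟨b, hb, hab⟩ ↦ h.isFullSet_annihilator ha hb hab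
  tfae_have 2 → 3 := fun h a ha ⟨b, hb, hab⟩ ↦
    exists_orthogonal_lhd_of_isFullSet hab (h a ha ⟨b, hb, hab⟩)
  tfae_have 3 → 4 := fun h a ha ε hε ↦ by
    obtain ⟨b, hb, hd, hab⟩ := exists_eq_mul_norm_sub_le ha (half_pos hε)
    obtain ⟨c, hc, hbc, hlhd⟩ := h b hb hd
    exact ⟨b, c, hb, hc, hab.trans_lt (half_lt_self hε), hbc, hlhd⟩
  tfae_have 4 → 1 := fun h ↦ isSoftCStar_of_exists_lhd_norm_lt_one fun a ha ↦ by
    obtain ⟨b, c, -, -, hab, hbc, hlhd⟩ := h a ha 1 one_pos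
    exact ⟨b, c, hab, hbc, hlhd⟩
  tfae_finish
end

section
/- A C*-algebra A has the Hjelmborg–Rørdam property if and only if for every a ∈ Aᶜ there exists b ∈ A₊ such that a ⊥ b and a is Cuntz subequivalent to b. -/
/-!
Common definitions: softness for (non-unital) C*-algebras.

A C*-algebra is *soft* if it has no nonzero unital quotient; equivalently, for every
closed two-sided ideal `I` with `A/I ≠ 0`, the quotient `A/I` is not unital.
We encode properties of the quotient `A/I` intrinsically in `A`.
-/

variable {A : Type*}

/-- `A` has the *Hjelmborg–Rørdam property*: for every `a ∈ Aᶜ` there exists `b ∈ A₊`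
with `a ⊥ b` and `a = x* x`, `b = x x*` for some `x ∈ A`. -/
def HjelmborgRordam (A : Type*) [NonUnitalCStarAlgebra A] [PartialOrder A]
    [StarOrderedRing A] : Prop :=
  ∀ a : A, 0 ≤ a → (∃ b : A, 0 ≤ b ∧ a = a * b) →
    ∃ b : A, 0 ≤ b ∧ a * b = 0 ∧ ∃ x : A, a = star x * x ∧ b = x * star x

/-- `a` is *Cuntz subequivalent* to `b`: `a = limₙ rₙ b rₙ*` for some sequence `(rₙ)`. -/
def CuntzSubequiv [NonUnitalCStarAlgebra A] (a b : A) : Prop :=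
  ∃ r : ℕ → A, Filter.Tendsto (fun n => r n * b * star (r n)) Filter.atTop (nhds a)

section

variable [NonUnitalCStarAlgebra A] [PartialOrder A] [StarOrderedRing A]

open Filter Topology

/-- If `s* s ≤ K r* r`, then `‖s y‖² ≤ K ‖r y‖²` for every `y` in the unitization. -/
lemma norm_sq_inr_mul_le {s r : A} {K : ℝ} (hK : 0 ≤ K)
    (h : star s * s ≤ K • (star r * r)) (y : Unitization ℂ A) :
    ‖(s : Unitization ℂ A) * y‖ ^ 2 ≤ K * ‖(r : Unitization ℂ A) * y‖ ^ 2 := by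
  have h1 : ((star s * s : A) : Unitization ℂ A) ≤ ((K • (star r * r) : A) : Unitization ℂ A) :=
    (Unitization.inr_le_iff _ _ (.star_mul_self s)
      ((IsSelfAdjoint.all K).smul (.star_mul_self r))).2 h
  have h2 := star_left_conjugate_le_conjugate h1 y
  have h3 := CStarAlgebra.norm_le_norm_of_nonneg_of_le
    (star_left_conjugate_nonneg (by
      rw [Unitization.inr_mul, Unitization.inr_star]; exact star_mul_self_nonneg _) y) h2
  have e1 : star y * ((star s * s : A) : Unitization ℂ A) * y
      = star ((s : Unitization ℂ A) * y) * ((s : Unitization ℂ A) * y) := by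
    simp [mul_assoc]
  have e2 : star y * ((K • (star r * r) : A) : Unitization ℂ A) * y
      = K • (star ((r : Unitization ℂ A) * y) * ((r : Unitization ℂ A) * y)) := by
    simp [mul_assoc]
  rw [e1, e2, norm_smul, CStarRing.norm_star_mul_self, CStarRing.norm_star_mul_self,
    Real.norm_of_nonneg hK] at h3
  simpa [sq] using h3

lemma norm_sq_mul_le {s r : A} {K : ℝ} (hK : 0 ≤ K)
    (h : star s * s ≤ K • (star r * r)) (y : A) :
    ‖s * y‖ ^ 2 ≤ K * ‖r * y‖ ^ 2 := by
  simpa only [← Unitization.inr_mul, Unitization.norm_inr] using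
    norm_sq_inr_mul_le hK h (y : Unitization ℂ A)

lemma norm_sq_sub_mul_le {s r : A} {K : ℝ} (hK : 0 ≤ K)
    (h : star s * s ≤ K • (star r * r)) (p : A) :
    ‖s - s * p‖ ^ 2 ≤ K * ‖r - r * p‖ ^ 2 := by
  simpa only [mul_sub, mul_one, ← Unitization.inr_mul, ← Unitization.inr_sub,
    Unitization.norm_inr] using norm_sq_inr_mul_le hK h (1 - (p : Unitization ℂ A))

lemma tendsto_mul_of_star_mul_self_le {s r : A} {K : ℝ} (hK : 0 ≤ K)
    (h : star s * s ≤ K • (star r * r)) {p : ℕ → A}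
    (hp : Tendsto (fun n => r * p n) atTop (𝓝 r)) :
    Tendsto (fun n => s * p n) atTop (𝓝 s) := by
  rw [tendsto_iff_norm_sub_tendsto_zero] at hp ⊢
  have h0 : Tendsto (fun n => √K * ‖r * p n - r‖) atTop (𝓝 0) := by
    simpa using hp.const_mul (√K)
  refine squeeze_zero (fun _ => norm_nonneg _) (fun n => ?_) h0
  refine (sq_le_sq₀ (norm_nonneg _) (by positivity)).1 ?_
  rw [mul_pow, Real.sq_sqrt hK, norm_sub_rev, norm_sub_rev (r * p n)]
  exact norm_sq_sub_mul_le hK h (p n)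

/-- For `q ≥ 0`, there are self-adjoint `g n` commuting with `√q` with `√q (√q g n) → √q`. -/
lemma exists_seq_sqrt_mul_tendsto {q : A} (hq : 0 ≤ q) :
    ∃ g : ℕ → A, (∀ n, IsSelfAdjoint (g n)) ∧
      (∀ n, g n * CFC.sqrt q = CFC.sqrt q * g n) ∧
      Tendsto (fun n => CFC.sqrt q * (CFC.sqrt q * g n)) atTop (𝓝 (CFC.sqrt q)) := by
  have hsq : CFC.sqrt q = cfcₙ Real.sqrt q := CFC.sqrt_eq_real_sqrt q hq
  set g : ℕ → ℝ → ℝ := fun n t => √t / (|t| + 1 / ((n : ℝ) + 1)) with hg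
  have hpos (n : ℕ) (t : ℝ) : 0 < |t| + 1 / ((n : ℝ) + 1) := by positivity
  have hgc (n : ℕ) : Continuous (g n) :=
    Real.continuous_sqrt.div₀ (by fun_prop) fun t => (hpos n t).ne'
  have hg0 (n : ℕ) : g n 0 = 0 := by simp [hg]
  refine ⟨fun n => cfcₙ (g n) q, fun n => cfcₙ_predicate _ _, fun n => ?_, ?_⟩
  · rw [hsq]; exact cfcₙ_commute_cfcₙ _ _ _
  · rw [tendsto_iff_norm_sub_tendsto_zero]
    have h0 : Tendsto (fun n : ℕ => √(1 / ((n : ℝ) + 1))) atTop (𝓝 0) := by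
      have h1 := (Real.continuous_sqrt.tendsto 0).comp
        (tendsto_one_div_add_atTop_nhds_zero_nat (𝕜 := ℝ))
      rwa [Real.sqrt_zero] at h1
    refine squeeze_zero (fun _ => norm_nonneg _) (fun n => ?_) h0
    have hc := hgc n
    have hz := hg0 n
    have e : CFC.sqrt q * (CFC.sqrt q * cfcₙ (g n) q) - CFC.sqrt q
        = cfcₙ (fun t => √t * (√t * g n t) - √t) q := by
      rw [cfcₙ_sub (fun t => √t * (√t * g n t)) Real.sqrt q,
        cfcₙ_mul Real.sqrt (fun t => √t * g n t) q, cfcₙ_mul Real.sqrt (g n) q, hsq]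
    rw [e]
    refine norm_cfcₙ_le fun t ht => ?_
    have ht0 : 0 ≤ t := quasispectrum_nonneg_of_nonneg q hq t ht
    have hε : (0 : ℝ) < 1 / ((n : ℝ) + 1) := by positivity
    simp only [hg]
    generalize 1 / ((n : ℝ) + 1) = ε at hε ⊢
    obtain ⟨u, hu, rfl⟩ : ∃ u : ℝ, 0 ≤ u ∧ u ^ 2 = t := ⟨√t, Real.sqrt_nonneg _, Real.sq_sqrt ht0⟩
    obtain ⟨v, hv, rfl⟩ : ∃ v : ℝ, 0 < v ∧ v ^ 2 = ε :=
      ⟨√ε, Real.sqrt_pos.2 hε, Real.sq_sqrt hε.le⟩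
    simp only [Real.sqrt_sq hu, Real.sqrt_sq hv.le, abs_of_nonneg (sq_nonneg u)]
    have e2 : u * (u * (u / (u ^ 2 + v ^ 2))) - u = -(u * v ^ 2 / (u ^ 2 + v ^ 2)) := by
      field_simp; ring
    rw [e2, norm_neg, Real.norm_of_nonneg (by positivity), div_le_iff₀ (by positivity)]
    nlinarith [mul_nonneg hv.le (sq_nonneg (u - v)), mul_nonneg hv.le (sq_nonneg u),
      mul_nonneg hv.le (sq_nonneg (u + v)), mul_nonneg hv.le (sq_nonneg v)]

/-- If `s² ≤ K v* v` with `s` self-adjoint, then `s² = x* x` for some `x` that is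
annihilated on the left by every `a` with `a v = 0`. -/
lemma exists_star_mul_self_eq_of_le {s v : A} (hs : IsSelfAdjoint s) {K : ℝ} (hK : 0 ≤ K)
    (h : s * s ≤ K • (star v * v)) :
    ∃ x : A, star x * x = s * s ∧ ∀ a : A, a * v = 0 → a * x = 0 := by
  set q := star v * v with hqdef
  have hq : 0 ≤ q := star_mul_self_nonneg v
  set r := CFC.sqrt q with hr
  have hrsa : star r = r := (CFC.sqrt_nonneg q).isSelfAdjoint.star_eq
  have hrr : star r * r = q := by rw [hrsa]; exact CFC.sqrt_mul_sqrt_self q hq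
  have hsr : star s * s ≤ K • (star r * r) := by rwa [hrr, hs.star_eq]
  obtain ⟨g, hgsa, hgcomm, hgt⟩ := exists_seq_sqrt_mul_tendsto hq
  have hvt : Tendsto (fun n => v * (r * g n)) atTop (𝓝 v) :=
    tendsto_mul_of_star_mul_self_le zero_le_one (by rw [hrr, one_smul]) hgt
  have hst : Tendsto (fun n => s * (r * g n)) atTop (𝓝 s) :=
    tendsto_mul_of_star_mul_self_le hK hsr hgt
  have hcau : CauchySeq (fun n => v * g n * s) := by
    have hc := hvt.cauchySeq
    rw [Metric.cauchySeq_iff] at hc ⊢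
    intro ε hε
    obtain ⟨N, hN⟩ := hc (ε / (√K + 1)) (by positivity)
    refine ⟨N, fun m hm n hn => ?_⟩
    have h1 := hN m hm n hn
    rw [dist_eq_norm] at h1 ⊢
    set y := v * g m - v * g n with hy
    have e1 : v * g m * s - v * g n * s = y * s := by rw [hy, sub_mul]
    have e2 : v * (r * g m) - v * (r * g n) = y * r := by
      rw [hy, sub_mul, mul_assoc, mul_assoc, hgcomm, hgcomm]
    rw [e2] at h1
    rw [e1]
    have h2 := norm_sq_mul_le hK hsr (star y)
    have e3 : ‖s * star y‖ = ‖y * s‖ := by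
      rw [← norm_star, star_mul, star_star, hs.star_eq]
    have e4 : ‖r * star y‖ = ‖y * r‖ := by
      rw [← norm_star, star_mul, star_star, hrsa]
    rw [e3, e4] at h2
    have h3 : ‖y * s‖ ≤ √K * ‖y * r‖ := by
      refine (sq_le_sq₀ (norm_nonneg _) (by positivity)).1 ?_
      rwa [mul_pow, Real.sq_sqrt hK]
    rw [lt_div_iff₀ (by positivity)] at h1
    nlinarith [norm_nonneg (y * r)]
  obtain ⟨x, hx⟩ := cauchySeq_tendsto_of_complete hcau
  refine ⟨x, ?_, fun a ha => ?_⟩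
  · have h1 : Tendsto (fun n => star (v * g n * s) * (v * g n * s)) atTop (𝓝 (star x * x)) :=
      hx.star.mul hx
    have h2 : Tendsto (fun n => (s * (r * g n)) * star (s * (r * g n))) atTop (𝓝 (s * star s)) :=
      hst.mul hst.star
    rw [hs.star_eq] at h2
    refine tendsto_nhds_unique h1 (h2.congr fun n => ?_)
    have e1 : star (v * g n * s) * (v * g n * s) = s * (g n * (q * (g n * s))) := by
      simp only [star_mul, hs.star_eq, (hgsa n).star_eq, hqdef, mul_assoc]
    have e2 : g n * (r * (r * (g n * s))) = r * (g n * (g n * (r * s))) := by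
      rw [← mul_assoc, hgcomm, mul_assoc, ← mul_assoc r (g n) s, ← hgcomm, mul_assoc]
    rw [e1, ← hrr, hrsa]
    simp only [star_mul, hs.star_eq, (hgsa n).star_eq, hrsa, mul_assoc, e2]
  · have h1 : Tendsto (fun n => a * (v * g n * s)) atTop (𝓝 (a * x)) := hx.const_mul a
    refine tendsto_nhds_unique h1 (tendsto_const_nhds.congr fun n => ?_)
    rw [← mul_assoc, ← mul_assoc, ha, zero_mul, zero_mul]

lemma sqrt_mul_eq_self {a b : A} (ha : 0 ≤ a) (hb : 0 ≤ b) (h : a = a * b) :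
    CFC.sqrt a * b = CFC.sqrt a := by
  have hba : b * a = a := by
    have := congrArg star h
    rw [star_mul, hb.isSelfAdjoint.star_eq, ha.isSelfAdjoint.star_eq] at this
    exact this.symm
  set s := CFC.sqrt a with hs
  have hss : s * s = a := CFC.sqrt_mul_sqrt_self a ha
  have hsa : star s = s := (CFC.sqrt_nonneg a).isSelfAdjoint.star_eq
  rw [← sub_eq_zero, ← CStarRing.star_mul_self_eq_zero_iff]
  simp only [star_sub, star_mul, hsa, hb.isSelfAdjoint.star_eq, sub_mul, mul_sub]
  have e1 : b * s * (s * b) = a := by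
    rw [mul_assoc, ← mul_assoc s s b, hss, ← h, hba]
  have e2 : b * s * s = a := by rw [mul_assoc, hss, hba]
  have e3 : s * (s * b) = a := by rw [← mul_assoc, hss, ← h]
  rw [e1, e2, e3, hss]; simp

lemma mul_sqrt_eq_zero {a b : A} (hb : 0 ≤ b) (h : a * b = 0) : a * CFC.sqrt b = 0 := by
  rw [← CStarRing.mul_star_self_eq_zero_iff, star_mul,
    (CFC.sqrt_nonneg b).isSelfAdjoint.star_eq, mul_assoc, ← mul_assoc (CFC.sqrt b),
    CFC.sqrt_mul_sqrt_self b hb, ← mul_assoc, h, zero_mul]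

/-- If `e ≥ 0`, there is `c ∈ Aᶜ` such that `2 c` acts as a unit on every `s` on which `e` does. -/
lemma exists_compact_unit {e : A} (he : 0 ≤ e) :
    ∃ c : A, 0 ≤ c ∧ (∃ f : A, 0 ≤ f ∧ c = c * f) ∧
      ∀ s : A, s * e = s → s * c = (1 / 2 : ℝ) • s := by
  have hden (t : ℝ) : (2 * max (1 - t) t) ≠ 0 := by
    have := le_max_left (1 - t) t
    have := le_max_right (1 - t) t
    intro h; linarith
  have hgc : Continuous (fun t : ℝ => -t / (2 * max (1 - t) t)) :=
    Continuous.div₀ (by fun_prop) (by fun_prop) hden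
  have hfc : Continuous (fun t : ℝ => max (t - 1 / 2) 0) := by fun_prop
  have hf0 : max ((0 : ℝ) - 1 / 2) 0 = 0 := by norm_num
  have hkc : Continuous (fun t : ℝ => min (2 * t) 1) := by fun_prop
  have hk0 : min (2 * (0 : ℝ)) 1 = 0 := by norm_num
  refine ⟨cfcₙ (fun t : ℝ => max (t - 1 / 2) 0) e, cfcₙ_nonneg fun t _ => le_max_right _ _,
    ⟨cfcₙ (fun t : ℝ => min (2 * t) 1) e, cfcₙ_nonneg fun t ht => ?_, ?_⟩, fun s hs => ?_⟩
  · have ht0 : 0 ≤ t := quasispectrum_nonneg_of_nonneg e he t ht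
    exact le_min (by linarith) zero_le_one
  · rw [← cfcₙ_mul (fun t : ℝ => max (t - 1 / 2) 0) (fun t : ℝ => min (2 * t) 1) e
      hfc.continuousOn hf0 hkc.continuousOn hk0]
    refine cfcₙ_congr fun t _ => ?_
    rcases le_total t (1 / 2) with h | h
    · simp only [max_eq_right (sub_nonpos.2 h), zero_mul]
    · simp only [min_eq_right (show 1 ≤ 2 * t by linarith), mul_one]
  · set g := cfcₙ (fun t : ℝ => -t / (2 * max (1 - t) t)) e with hg
    have key : cfcₙ (fun t : ℝ => max (t - 1 / 2) 0) e = (1 / 2 : ℝ) • e + (g - e * g) := by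
      have e1 : e * g = cfcₙ (fun t : ℝ => t * (-t / (2 * max (1 - t) t))) e := by
        rw [cfcₙ_mul (fun t : ℝ => t) (fun t : ℝ => -t / (2 * max (1 - t) t)) e
          continuousOn_id rfl hgc.continuousOn (by simp), cfcₙ_id' ℝ e]
      have hmc : Continuous (fun t : ℝ => t * (-t / (2 * max (1 - t) t))) := continuous_id.mul hgc
      rw [e1, hg, ← cfcₙ_sub _ _ e hgc.continuousOn (by simp) hmc.continuousOn (by simp),
        ← cfcₙ_smul_id (R := ℝ) (1 / 2 : ℝ) e,
        ← cfcₙ_add (fun t : ℝ => (1 / 2 : ℝ) • t)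
          (fun t : ℝ => -t / (2 * max (1 - t) t) - t * (-t / (2 * max (1 - t) t))) e
          (continuous_const_smul (1 / 2 : ℝ)).continuousOn (by simp)
          (hgc.sub hmc).continuousOn (by simp)]
      refine cfcₙ_congr fun t _ => ?_
      have hd := hden t
      rcases le_total t (1 / 2) with h | h
      · have hm : max (1 - t) t = 1 - t := max_eq_left (by linarith)
        have : 1 - t ≠ 0 := by linarith
        simp only [max_eq_right (sub_nonpos.2 h), hm, smul_eq_mul]
        field_simp; ring
      · have hm : max (1 - t) t = t := max_eq_right (by linarith)
        have : t ≠ 0 := by linarith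
        simp only [max_eq_left (sub_nonneg.2 h), hm, smul_eq_mul]
        field_simp; ring
    rw [key, mul_add, mul_sub, ← mul_assoc, hs, sub_self, add_zero, mul_smul_comm, hs]

end

/-- `A` has the Hjelmborg–Rørdam property iff for every `a ∈ Aᶜ` there
is `b ∈ A₊` with `a ⊥ b` and `a ≾ b` (Cuntz subequivalence). -/
theorem hjelmborgRordam_iff_cuntz [NonUnitalCStarAlgebra A] [PartialOrder A]
    [StarOrderedRing A] :
    HjelmborgRordam A ↔
      ∀ a : A, 0 ≤ a → (∃ b : A, 0 ≤ b ∧ a = a * b) →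
        ∃ b : A, 0 ≤ b ∧ a * b = 0 ∧ CuntzSubequiv a b := by
  constructor
  · rintro h a ha ⟨e, he, hae⟩
    have hs := CFC.sqrt_mul_sqrt_self a ha
    obtain ⟨b, hb, hab, x, hx, rfl⟩ :=
      h (CFC.sqrt a) (CFC.sqrt_nonneg a) ⟨e, he, (sqrt_mul_eq_self ha he hae).symm⟩
    refine ⟨x * star x, hb, by rw [← hs, mul_assoc, hab, mul_zero], fun _ => star x, ?_⟩
    have : star x * (x * star x) * star (star x) = a := by
      rw [star_star, ← mul_assoc, mul_assoc, ← hx, hs]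
    simp only [this, tendsto_const_nhds]
  · rintro h a ha ⟨e, he, hae⟩
    obtain ⟨c, hc, hcc, hunit⟩ := exists_compact_unit he
    obtain ⟨b, hb, hcb, r, hr⟩ := h c hc hcc
    have hss := CFC.sqrt_mul_sqrt_self a ha
    have hsc := hunit _ (sqrt_mul_eq_self ha he hae)
    have hssa : IsSelfAdjoint (CFC.sqrt a) := (CFC.sqrt_nonneg a).isSelfAdjoint
    set s := CFC.sqrt a with hs
    have hab : a * b = 0 := by
      have h1 : (1 / 2 : ℝ) • (a * b) = 0 := by
        rw [← smul_mul_assoc, ← hunit a hae.symm, mul_assoc, hcb, mul_zero]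
      exact (smul_eq_zero.1 h1).resolve_left (by norm_num)
    obtain ⟨n, hn⟩ := ((tendsto_iff_norm_sub_tendsto_zero.1 hr).eventually
      (gt_mem_nhds (show (0 : ℝ) < 1 / 4 by norm_num))).exists
    set y := r n * b * star (r n) with hy
    have hysa : IsSelfAdjoint y := (star_right_conjugate_nonneg hb (r n)).isSelfAdjoint
    set v := CFC.sqrt b * star (r n) * s with hv
    have hvv : star v * v = s * y * s := by
      rw [hy, ← CFC.sqrt_mul_sqrt_self b hb]
      simp only [hv, star_mul, star_star, hssa.star_eq,
        (CFC.sqrt_nonneg b).isSelfAdjoint.star_eq, mul_assoc]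
    have h1 := CStarAlgebra.star_left_conjugate_le_norm_smul (a := s)
      (hc.isSelfAdjoint.sub hysa)
    rw [hssa.star_eq, mul_sub, sub_mul, hsc, smul_mul_assoc, hss, ← hvv, norm_sub_rev] at h1
    have h2 : ‖y - c‖ • a ≤ (1 / 4 : ℝ) • a := smul_le_smul_of_nonneg_right hn.le ha
    have h3 : (1 / 4 : ℝ) • a ≤ star v * v := by
      have h4 := sub_le_iff_le_add.1 (h1.trans h2)
      have e : (1 / 2 : ℝ) • a = (1 / 4 : ℝ) • a + (1 / 4 : ℝ) • a := by
        rw [← add_smul]; norm_num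
      rw [e] at h4
      exact le_of_add_le_add_left h4
    have h5 : s * s ≤ (4 : ℝ) • (star v * v) := by
      have h6 := smul_le_smul_of_nonneg_left h3 (show (0 : ℝ) ≤ 4 by norm_num)
      rw [smul_smul] at h6
      rw [hss]
      simpa using h6
    obtain ⟨x, hx, hax⟩ := exists_star_mul_self_eq_of_le hssa (by norm_num) h5
    refine ⟨x * star x, mul_star_self_nonneg x, ?_, x, by rw [hx, hss], rfl⟩
    rw [← mul_assoc, hax a, zero_mul]
    rw [hv, ← mul_assoc, ← mul_assoc, mul_sqrt_eq_zero hb hab, zero_mul, zero_mul]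
end

section
/- Every C*-algebra with the Hjelmborg–Rørdam property is soft: if for every a ∈ Aᶜ there exists b ∈ A₊ such that a ⊥ b and such that a = x*x, b = xx* for some x ∈ A, then A has no nonzero unital quotient. -/
/-!
Common definitions: softness for (non-unital) C*-algebras.

A C*-algebra is *soft* if it has no nonzero unital quotient; equivalently, for every
closed two-sided ideal `I` with `A/I ≠ 0`, the quotient `A/I` is not unital.
We encode properties of the quotient `A/I` intrinsically in `A`.
-/

variable {A : Type*}

/-- If `e` is a left unit modulo a closed two-sided ideal `I` and `‖e - e * a‖ < 1`, then
multiplication by `a` is injective modulo `I`. -/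
theorem TwoSidedIdeal.mem_of_mul_mem_of_norm_sub_lt_one {A : Type*} [NonUnitalNormedRing A]
    {I : TwoSidedIdeal A} (hI : IsClosed (I : Set A)) {e a : A}
    (he : ∀ x : A, e * x - x ∈ I) (ha : ‖e - e * a‖ < 1) {x : A} (hx : a * x ∈ I) : x ∈ I := by
  set z := e - e * a with hz
  have h1 : x - z * x ∈ I := by
    have h : x - z * x = e * (a * x) - (e * x - x) := by rw [hz]; noncomm_ring
    rw [h]
    exact I.sub_mem (I.mul_mem_left _ _ hx) (he x)
  have h2 : ∀ n : ℕ, x - (fun y => z * y)^[n] x ∈ I := by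
    intro n
    induction n with
    | zero => simp
    | succ n ih =>
      rw [Function.iterate_succ_apply']
      have h : x - z * (fun y => z * y)^[n] x
          = (x - z * x) + z * (x - (fun y => z * y)^[n] x) := by noncomm_ring
      rw [h]
      exact I.add_mem h1 (I.mul_mem_left _ _ ih)
  have h3 : ∀ n : ℕ, ‖(fun y => z * y)^[n] x‖ ≤ ‖z‖ ^ n * ‖x‖ := by
    intro n
    induction n with
    | zero => simp
    | succ n ih =>
      rw [Function.iterate_succ_apply', pow_succ', mul_assoc]
      exact (norm_mul_le _ _).trans (by gcongr)
  have h4 : Filter.Tendsto (fun n : ℕ => (fun y => z * y)^[n] x) Filter.atTop (nhds 0) := by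
    refine squeeze_zero_norm h3 ?_
    simpa using (tendsto_pow_atTop_nhds_zero_of_lt_one (norm_nonneg z) ha).mul_const ‖x‖
  have h5 := tendsto_const_nhds (x := x) |>.sub h4
  rw [sub_zero] at h5
  exact hI.mem_of_tendsto h5 (Filter.Eventually.of_forall h2)

/-- Every element of a C*-algebra is almost fixed under right multiplication by a positive
element that has a positive local unit. -/
theorem CStarAlgebra.exists_nonneg_eq_mul_norm_sub_mul_lt_one {A : Type*}
    [NonUnitalCStarAlgebra A] [PartialOrder A] [StarOrderedRing A] (e : A) :
    ∃ a : A, 0 ≤ a ∧ (∃ c : A, 0 ≤ c ∧ a = a * c) ∧ ‖e - e * a‖ < 1 := by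
  let f : ℝ → ℝ := fun t => max 0 (min 1 (4 * t - 1))
  let g : ℝ → ℝ := fun t => max 0 (min 1 (4 * t))
  have hf : Continuous f := by fun_prop
  have hg : Continuous g := by fun_prop
  have hf0 : f 0 = 0 := by simp [f]
  have hg0 : g 0 = 0 := by simp [g]
  have hh : 0 ≤ star e * e := star_mul_self_nonneg e
  set h := star e * e with h_def
  have hsa : IsSelfAdjoint h := hh.isSelfAdjoint
  refine ⟨cfcₙ f h, cfcₙ_nonneg fun t _ => le_max_left _ _,
    ⟨cfcₙ g h, cfcₙ_nonneg fun t _ => le_max_left _ _, ?_⟩, ?_⟩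
  · rw [← cfcₙ_mul f g h hf.continuousOn hf0 hg.continuousOn hg0]
    congr 1
    ext t
    simp only [f, g]
    rcases le_total (4 * t) 1 with ht | ht
    · rw [max_eq_left ((min_le_right _ _).trans (by linarith)), zero_mul]
    · rw [min_eq_left ht, max_eq_right zero_le_one, mul_one]
  · set a := cfcₙ f h with a_def
    have ha : star a = a := (cfcₙ_predicate f h : IsSelfAdjoint a).star_eq
    have key : star (e - e * a) * (e - e * a)
        = cfcₙ (fun t : ℝ => t - t * f t - (f t * t - f t * t * f t)) h := by
      have hid : cfcₙ (fun t : ℝ => t) h = h := cfcₙ_id' ℝ h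
      rw [cfcₙ_sub (fun t : ℝ => t - t * f t) (fun t => f t * t - f t * t * f t) h
          (by fun_prop) (by simp) (by fun_prop) (by simp),
        cfcₙ_sub (fun t : ℝ => t) (fun t => t * f t) h
          (by fun_prop) (by simp) (by fun_prop) (by simp),
        cfcₙ_sub (fun t : ℝ => f t * t) (fun t => f t * t * f t) h
          (by fun_prop) (by simp) (by fun_prop) (by simp),
        cfcₙ_mul (fun t : ℝ => f t * t) f h (by fun_prop) (by simp) (by fun_prop) hf0,
        cfcₙ_mul (fun t : ℝ => t) f h (by fun_prop) rfl (by fun_prop) hf0,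
        cfcₙ_mul f (fun t : ℝ => t) h (by fun_prop) hf0 (by fun_prop) rfl,
        hid, ← a_def, star_sub, star_mul, ha, h_def]
      noncomm_ring
    have hle : ‖e - e * a‖ * ‖e - e * a‖ ≤ 1 / 2 := by
      rw [← CStarRing.norm_star_mul_self, key]
      refine norm_cfcₙ_le fun t ht => ?_
      have ht0 : 0 ≤ t := quasispectrum_nonneg_of_nonneg h hh t ht
      have hform : t - t * f t - (f t * t - f t * t * f t) = t * (1 - f t) ^ 2 := by ring
      have hf_nonneg : 0 ≤ f t := le_max_left _ _
      have hf_le : f t ≤ 1 := max_le zero_le_one (min_le_left _ _)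
      rw [hform, Real.norm_of_nonneg (by positivity)]
      rcases le_total t (1 / 2) with h2 | h2
      · nlinarith [mul_nonneg ht0 (mul_nonneg hf_nonneg (by linarith : (0 : ℝ) ≤ 2 - f t))]
      · have hf1 : f t = 1 := by
          simp only [f]
          rw [min_eq_left (by linarith), max_eq_right zero_le_one]
        rw [hf1]
        norm_num
    nlinarith [norm_nonneg (e - e * a)]

/-- Every C*-algebra with the Hjelmborg–Rørdam property is soft:
if for every `a ∈ Aᶜ` (i.e. `0 ≤ a` with `a = a c` for some `0 ≤ c`) there exists
`b ∈ A₊` orthogonal to `a` with `a = x* x` and `b = x x*` for some `x ∈ A`,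
then `A` has no nonzero unital quotient. -/
theorem isSoftCStar_of_hjelmborgRordam [NonUnitalCStarAlgebra A] [PartialOrder A]
    [StarOrderedRing A]
    (hHR : ∀ a : A, 0 ≤ a → (∃ c : A, 0 ≤ c ∧ a = a * c) →
      ∃ b : A, 0 ≤ b ∧ a * b = 0 ∧ ∃ x : A, a = star x * x ∧ b = x * star x) :
    IsSoftCStar A := by
  rintro I hI ⟨y, hy⟩ ⟨e, he⟩
  obtain ⟨a, ha, hc, hnorm⟩ := CStarAlgebra.exists_nonneg_eq_mul_norm_sub_mul_lt_one e
  have cancel : ∀ {x : A}, a * x ∈ I → x ∈ I :=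
    I.mem_of_mul_mem_of_norm_sub_lt_one hI (fun x => (he x).2) hnorm
  obtain ⟨b, -, hab, x, hax, hbx⟩ := hHR a ha hc
  have hb : b ∈ I := cancel (hab ▸ I.zero_mem)
  have haa : a * a ∈ I := by
    have h : a * a = star x * b * x := by rw [hax, hbx]; noncomm_ring
    rw [h]
    exact I.mul_mem_right _ _ (I.mul_mem_left _ _ hb)
  exact hy (cancel (I.mul_mem_right _ _ (cancel haa)))
end

section
/- Let A be a C*-algebra and x ∈ A. The following are equivalent: (1) x is soft; (2) x* is soft; (3) the positive element x*x is soft; (4) the positive element xx* is soft. -/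
/-!
Common definitions: softness for (non-unital) C*-algebras.

A C*-algebra is *soft* if it has no nonzero unital quotient; equivalently, for every
closed two-sided ideal `I` with `A/I ≠ 0`, the quotient `A/I` is not unital.
We encode properties of the quotient `A/I` intrinsically in `A`.
-/

variable {A : Type*}

/-- The hereditary subalgebra associated to `x`: the closed linear span of `x* A x`
(the set `{x* y x : y ∈ A}` is closed under multiplication, so the non-unital
subalgebra it generates is its linear span). -/
def her [NonUnitalCStarAlgebra A] (x : A) : NonUnitalSubalgebra ℂ A :=
  (NonUnitalAlgebra.adjoin ℂ {z : A | ∃ y : A, z = star x * y * x}).topologicalClosure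

/-- An element `x` of a C*-algebra is *soft* if its hereditary subalgebra
`her x = span(x* A x)‾` is a soft C*-algebra. -/
def IsSoftElem [NonUnitalCStarAlgebra A] (x : A) : Prop :=
  IsSoftCStar (her x)

theorem IsSoftCStar.of_ringEquiv {R S : Type*} [NonUnitalNonAssocRing R] [TopologicalSpace R]
    [NonUnitalNonAssocRing S] [TopologicalSpace S] (e : R ≃+* S) (he : Continuous e)
    (hR : IsSoftCStar R) : IsSoftCStar S := by
  rintro I hI ⟨s, hs⟩ ⟨u, hu⟩
  have hmem (r : R) : r ∈ I.comap e ↔ e r ∈ I := TwoSidedIdeal.mem_comap ..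
  refine hR (I.comap e) ?_ ⟨e.symm s, by simpa [hmem] using hs⟩
    ⟨e.symm u, fun r => by simpa [hmem] using hu (e r)⟩
  have : (I.comap e : Set R) = e ⁻¹' I := Set.ext hmem
  rw [this]
  exact hI.preimage he

section Her

variable [NonUnitalCStarAlgebra A]

theorem coe_her (x : A) : (her x : Set A) = closure (Set.range fun y => star x * y * x) := by
  have h : (NonUnitalAlgebra.adjoin ℂ {z : A | ∃ y : A, z = star x * y * x} : Set A) =
      Set.range fun y => star x * y * x := by
    refine Set.Subset.antisymm (fun z hz => ?_) ?_
    · induction hz using NonUnitalAlgebra.adjoin_induction with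
      | mem z hz => obtain ⟨y, rfl⟩ := hz; exact ⟨y, rfl⟩
      | zero => exact ⟨0, by simp⟩
      | add a b _ _ ha hb =>
        obtain ⟨y, rfl⟩ := ha
        obtain ⟨z, rfl⟩ := hb
        exact ⟨y + z, by simp only [mul_add, add_mul]⟩
      | mul a b _ _ ha hb =>
        obtain ⟨y, rfl⟩ := ha
        obtain ⟨z, rfl⟩ := hb
        exact ⟨y * x * star x * z, by simp only [mul_assoc]⟩
      | smul r a _ ha =>
        obtain ⟨y, rfl⟩ := ha
        exact ⟨r • y, by simp only [mul_smul_comm, smul_mul_assoc]⟩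
    · rintro _ ⟨y, rfl⟩
      exact NonUnitalAlgebra.subset_adjoin ℂ ⟨y, rfl⟩
  rw [← h]
  rfl

theorem mem_closure_range_mul_star_mul_self (x : A) :
    x ∈ closure (Set.range fun w => w * (star x * x)) := by
  rw [Metric.mem_closure_range_iff]
  intro ε hε
  set h := star x * x with hh
  have hsa : IsSelfAdjoint h := IsSelfAdjoint.star_mul_self x
  let δ : ℝ := ε ^ 2 / 2
  have hδ : 0 < δ := by positivity
  have hpos (t : ℝ) : 0 < t ^ 2 + δ ^ 2 := by positivity
  obtain ⟨f, hf, hf0, hf_eq⟩ : ∃ f : ℝ → ℝ, Continuous f ∧ f 0 = 0 ∧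
      ∀ t, f t = t / (t ^ 2 + δ ^ 2) :=
    ⟨fun t => t / (t ^ 2 + δ ^ 2), continuous_id.div (by fun_prop) fun t => (hpos t).ne',
      by simp, fun _ => rfl⟩
  set g := cfcₙ f h with hg
  have hgsa : star g = g := (cfcₙ_predicate (R := ℝ) _ h : IsSelfAdjoint g).star_eq
  have hid : cfcₙ (fun t : ℝ => t) h = h := cfcₙ_id' ℝ h
  refine ⟨x * g, ?_⟩
  have key : star (x - x * g * h) * (x - x * g * h) =
      cfcₙ (fun t : ℝ => t - t * f t * t - (t * f t * t - t * f t * t * f t * t)) h := by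
    rw [cfcₙ_sub _ _ h (by fun_prop) (by simp) (by fun_prop) (by simp),
      cfcₙ_sub _ _ h (by fun_prop) (by simp) (by fun_prop) (by simp),
      cfcₙ_sub _ _ h (by fun_prop) (by simp) (by fun_prop) (by simp),
      cfcₙ_mul _ _ h (by fun_prop) (by simp) (by fun_prop) (by simp),
      cfcₙ_mul _ _ h (by fun_prop) (by simp) (by fun_prop) (by simpa),
      cfcₙ_mul _ _ h (by fun_prop) (by simp) (by fun_prop) (by simp),
      cfcₙ_mul _ _ h (by fun_prop) (by simp) (by fun_prop) (by simpa),
      cfcₙ_mul _ _ h (by fun_prop) (by simp) (by fun_prop) (by simp),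
      cfcₙ_mul _ _ h (by fun_prop) (by simp) (by fun_prop) (by simpa), hid, ← hg]
    simp only [star_sub, star_mul, hgsa, sub_mul, mul_sub, hh, mul_assoc, star_star]
  have hle : ‖star (x - x * g * h) * (x - x * g * h)‖ ≤ δ := by
    rw [key]
    refine norm_cfcₙ_le fun t _ => ?_
    have ht : t - t * f t * t - (t * f t * t - t * f t * t * f t * t)
        = t * δ ^ 4 / (t ^ 2 + δ ^ 2) ^ 2 := by
      rw [hf_eq]
      field_simp [(hpos t).ne']
      ring
    rw [ht, Real.norm_eq_abs, abs_div, abs_mul, abs_of_pos (pow_pos hδ 4),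
      abs_of_pos (pow_pos (hpos t) 2), div_le_iff₀ (pow_pos (hpos t) 2), ← sq_abs t]
    have h2 : 2 * |t| * δ ≤ |t| ^ 2 + δ ^ 2 := two_mul_le_add_sq _ _
    have h0 := abs_nonneg t
    calc |t| * δ ^ 4 ≤ δ * (δ ^ 2 * (|t| ^ 2 + δ ^ 2)) := by
          nlinarith [mul_le_mul_of_nonneg_left h2 (pow_pos hδ 3).le,
            mul_nonneg h0 (pow_pos hδ 4).le]
      _ ≤ δ * (|t| ^ 2 + δ ^ 2) ^ 2 := by
          rw [sq (|t| ^ 2 + δ ^ 2)]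
          gcongr
          nlinarith [sq_nonneg |t|]
  rw [CStarRing.norm_star_mul_self] at hle
  rw [dist_eq_norm]
  refine lt_of_pow_lt_pow_left₀ 2 hε.le ?_
  have : δ < ε ^ 2 := half_lt_self (by positivity)
  linarith [sq ‖x - x * g * h‖]

theorem her_star_mul_self (x : A) : her (star x * x) = her x := by
  refine SetLike.coe_injective ?_
  rw [coe_her, coe_her]
  refine Set.Subset.antisymm (closure_mono ?_) (closure_minimal ?_ isClosed_closure)
  · rintro _ ⟨y, rfl⟩
    exact ⟨x * y * star x, by simp [mul_assoc]⟩
  · rintro _ ⟨y, rfl⟩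
    refine map_mem_closure (f := fun u => star u * y * u) (by fun_prop)
      (mem_closure_range_mul_star_mul_self x) ?_
    rintro _ ⟨w, rfl⟩
    exact ⟨star w * y * w, by simp [mul_assoc]⟩

theorem norm_mul_eq_of_star_mul_self_eq {a b : A} (h : star a * a = star b * b) (z : A) :
    ‖a * z‖ = ‖b * z‖ := by
  refine (mul_self_inj (norm_nonneg _) (norm_nonneg _)).mp ?_
  rw [← CStarRing.norm_star_mul_self, ← CStarRing.norm_star_mul_self]
  have (c : A) : star (c * z) * (c * z) = star z * (star c * c) * z := by simp [mul_assoc]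
  rw [this, this, h]

theorem norm_mul_star_eq_of_star_mul_self_eq {a b : A} (h : star a * a = star b * b) (z : A) :
    ‖z * star a‖ = ‖z * star b‖ := by
  rw [← norm_star, ← norm_star (z * star b)]
  simpa using norm_mul_eq_of_star_mul_self_eq h (star z)

/-- The closure of `{(a y a*, b y b*) : y ∈ A}`, which is a subalgebra when `a* a = b* b`. It is the
graph of an isometric isomorphism between the hereditary subalgebras of `a*` and `b*`. -/
def herGraph (a b : A) (h : star a * a = star b * b) : NonUnitalSubalgebra ℂ (A × A) :=
  NonUnitalSubalgebra.topologicalClosure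
    { carrier := Set.range fun y => (a * y * star a, b * y * star b)
      zero_mem' := ⟨0, by simp⟩
      add_mem' := by
        rintro _ _ ⟨y, rfl⟩ ⟨z, rfl⟩
        exact ⟨y + z, by simp only [mul_add, add_mul, Prod.mk_add_mk]⟩
      mul_mem' := by
        rintro _ _ ⟨y, rfl⟩ ⟨z, rfl⟩
        refine ⟨y * (star a * a) * z, Prod.ext ?_ ?_⟩
        · simp only [mul_assoc, Prod.mk_mul_mk]
        · simp only [h, mul_assoc, Prod.mk_mul_mk]
      smul_mem' := by
        rintro r _ ⟨y, rfl⟩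
        exact ⟨r • y, by simp only [mul_smul_comm, smul_mul_assoc, Prod.smul_mk]⟩ }

theorem norm_fst_eq_norm_snd_of_mem_herGraph {a b : A} (h : star a * a = star b * b)
    {p : A × A} (hp : p ∈ herGraph a b h) :
    ‖p.1‖ = ‖p.2‖ := by
  refine closure_minimal (t := {p : A × A | ‖p.1‖ = ‖p.2‖}) ?_
    (isClosed_eq (by fun_prop) (by fun_prop)) hp
  rintro _ ⟨y, rfl⟩
  change ‖a * y * star a‖ = ‖b * y * star b‖
  rw [norm_mul_star_eq_of_star_mul_self_eq h, mul_assoc, norm_mul_eq_of_star_mul_self_eq h,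
    mul_assoc]

/-- A homomorphism that is isometric on the graph and maps its generators onto `c A c*` identifies
the graph with the hereditary subalgebra of `c*`. -/
theorem exists_ringEquiv_herGraph {a b : A} (h : star a * a = star b * b)
    (c : A) (f : A × A →ₙₐ[ℂ] A) (hf : Continuous f)
    (hnorm : ∀ p ∈ herGraph a b h, ‖f p‖ = ‖p‖)
    (hgen : ∀ y, f (a * y * star a, b * y * star b) = c * y * star c) :
    ∃ e : herGraph a b h ≃+* her (star c), Continuous e ∧ Continuous e.symm := by
  have hmem (p : herGraph a b h) : f p ∈ her (star c) := by
    rw [← SetLike.mem_coe, coe_her]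
    refine map_mem_closure hf p.2 ?_
    rintro _ ⟨y, rfl⟩
    exact ⟨y, by simp [hgen]⟩
  let g : herGraph a b h →ₙ+* her (star c) :=
    { toFun := fun p => ⟨f p, hmem p⟩
      map_mul' := fun p q => Subtype.ext (map_mul f _ _)
      map_zero' := Subtype.ext (map_zero f)
      map_add' := fun p q => Subtype.ext (map_add f _ _) }
  have hg : Isometry fun p : herGraph a b h => f p := by
    refine Isometry.of_dist_eq fun p q => ?_
    rw [dist_eq_norm, ← map_sub, Subtype.dist_eq, dist_eq_norm]
    exact hnorm _ (sub_mem p.2 q.2)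
  have : CompleteSpace (herGraph a b h) :=
    (NonUnitalSubalgebra.isClosed_topologicalClosure _).completeSpace_coe
  have hgi : Isometry g := fun p q => hg p q
  have hsurj : Function.Surjective g := by
    rintro ⟨z, hz⟩
    rw [← SetLike.mem_coe, coe_her] at hz
    have : z ∈ Set.range fun p : herGraph a b h => f p := by
      refine closure_minimal ?_ hg.isClosedEmbedding.isClosed_range hz
      rintro _ ⟨y, rfl⟩
      exact ⟨⟨_, subset_closure ⟨y, rfl⟩⟩, by simp [hgen]⟩
    obtain ⟨p, hp⟩ := this
    exact ⟨p, Subtype.ext hp⟩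
  let e := RingEquiv.ofBijective g ⟨hgi.injective, hsurj⟩
  exact ⟨e, hgi.continuous, (hgi.right_inv e.apply_symm_apply).continuous⟩

theorem IsSoftElem.star_of_star_mul_self_eq {a b : A} (h : star a * a = star b * b)
    (ha : IsSoftElem (star a)) : IsSoftElem (star b) := by
  have heq {p : A × A} (hp : p ∈ herGraph a b h) := norm_fst_eq_norm_snd_of_mem_herGraph h hp
  obtain ⟨e, -, he⟩ := exists_ringEquiv_herGraph h a (NonUnitalAlgHom.fst ℂ A A) continuous_fst
    (fun p hp => by simp [Prod.norm_def, ← heq hp]) (fun _ => rfl)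
  obtain ⟨e', he', -⟩ := exists_ringEquiv_herGraph h b (NonUnitalAlgHom.snd ℂ A A) continuous_snd
    (fun p hp => by simp [Prod.norm_def, heq hp]) (fun _ => rfl)
  exact ha.of_ringEquiv (e.symm.trans e') (he'.comp he)

theorem isSoftElem_star_mul_self (x : A) : IsSoftElem (star x * x) ↔ IsSoftElem x := by
  rw [IsSoftElem, IsSoftElem, her_star_mul_self]

protected theorem IsSoftElem.star {x : A} (hx : IsSoftElem x) : IsSoftElem (star x) := by
  let _ := CStarAlgebra.spectralOrder A
  let _ := CStarAlgebra.spectralOrderedRing A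
  have hsa : star (CFC.sqrt (star x * x)) = CFC.sqrt (star x * x) :=
    (CFC.sqrt_nonneg (star x * x)).isSelfAdjoint.star_eq
  have hsq : star (CFC.sqrt (star x * x)) * CFC.sqrt (star x * x) = star x * x := by
    rw [hsa, CFC.sqrt_mul_sqrt_self _ (star_mul_self_nonneg x)]
  refine IsSoftElem.star_of_star_mul_self_eq hsq ?_
  rwa [hsa, ← isSoftElem_star_mul_self, hsq, isSoftElem_star_mul_self]

end Her

/-- For an element `x` of a C*-algebra, the following are equivalent:
`x` is soft; `x*` is soft; `x* x` is soft; `x x*` is soft. -/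
theorem isSoftElem_tfae [NonUnitalCStarAlgebra A] (x : A) :
    List.TFAE
      [ IsSoftElem x,
        IsSoftElem (star x),
        IsSoftElem (star x * x),
        IsSoftElem (x * star x) ] := by
  have h (y : A) : IsSoftElem y ↔ IsSoftElem (star y) :=
    ⟨.star, fun hy => by simpa using hy.star⟩
  tfae_have 1 ↔ 2 := h x
  tfae_have 1 ↔ 3 := (isSoftElem_star_mul_self x).symm
  tfae_have 2 ↔ 4 := by simpa using (isSoftElem_star_mul_self (star x)).symm
  tfae_finish
end

section
/- A C*-algebra A is projectionless (i.e., for every closed two-sided ideal I ⊆ A, the quotient A/I contains no nonzero projection) if and only if every element of A is soft. -/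
/-!
Common definitions: softness for (non-unital) C*-algebras.

A C*-algebra is *soft* if it has no nonzero unital quotient; equivalently, for every
closed two-sided ideal `I` with `A/I ≠ 0`, the quotient `A/I` is not unital.
We encode properties of the quotient `A/I` intrinsically in `A`.
-/

variable {A : Type*}

theorem exists_norm_sub_mul_sq_le [NonUnitalCStarAlgebra A] (d : A) {η : ℝ} (hη : 0 < η) :
    ∃ y : A, ‖d - d * (star d * d * y * (star d * d))‖ ^ 2 ≤ η := by
  have hb : IsSelfAdjoint (star d * d) := .star_mul_self d
  generalize hbd : star d * d = b at hb
  have hpos (t : ℝ) : 0 < η ^ 4 + t ^ 4 := by positivity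
  have hcont : Continuous fun t : ℝ => t ^ 2 / (η ^ 4 + t ^ 4) :=
    (by fun_prop : Continuous fun t : ℝ => t ^ 2).div (by fun_prop) fun t => (hpos t).ne'
  set h : ℝ → ℝ := fun t => t ^ 2 / (η ^ 4 + t ^ 4) with hh
  have h0 : h 0 = 0 := by simp [hh]
  refine ⟨cfcₙ h b, ?_⟩
  have hy : IsSelfAdjoint (cfcₙ h b) := cfcₙ_predicate h b
  have key : cfcₙ (fun t : ℝ => (t - t * (t * h t * t)) - (t * h t * t) * (t - t * (t * h t * t))) b
      = (b - b * (b * cfcₙ h b * b)) - (b * cfcₙ h b * b) * (b - b * (b * cfcₙ h b * b)) := by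
    have hid : cfcₙ (fun t : ℝ => t) b = b := cfcₙ_id' ℝ b
    have hc := hcont.continuousOn (s := quasispectrum ℝ b)
    have e1 : cfcₙ (fun t : ℝ => t * h t * t) b = b * cfcₙ h b * b := by
      rw [cfcₙ_mul (fun t => t * h t) (fun t => t) b (by fun_prop) (by simp) (by fun_prop) rfl,
        cfcₙ_mul (fun t => t) h b (by fun_prop) rfl (by fun_prop) h0, hid]
    have e2 : cfcₙ (fun t : ℝ => t - t * (t * h t * t)) b = b - b * (b * cfcₙ h b * b) := by
      rw [cfcₙ_sub (fun t => t) (fun t => t * (t * h t * t)) b (by fun_prop) rfl (by fun_prop)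
        (by simp), cfcₙ_mul (fun t => t) (fun t => t * h t * t) b (by fun_prop) rfl (by fun_prop)
        (by simp), e1, hid]
    rw [cfcₙ_sub (fun t => t - t * (t * h t * t))
      (fun t => (t * h t * t) * (t - t * (t * h t * t))) b (by fun_prop) (by simp) (by fun_prop)
      (by simp), cfcₙ_mul (fun t => t * h t * t) (fun t => t - t * (t * h t * t)) b (by fun_prop)
      (by simp) (by fun_prop) (by simp), e1, e2]
  have hz : star (d - d * (b * cfcₙ h b * b)) * (d - d * (b * cfcₙ h b * b)) =
      (b - b * (b * cfcₙ h b * b)) - (b * cfcₙ h b * b) * (b - b * (b * cfcₙ h b * b)) := by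
    have hc : star (b * cfcₙ h b * b) = b * cfcₙ h b * b := by
      simp only [star_mul, hb.star_eq, hy.star_eq, mul_assoc]
    generalize b * cfcₙ h b * b = c at hc ⊢
    rw [star_sub, star_mul, hc, ← hbd]
    noncomm_ring
  rw [sq, ← CStarRing.norm_star_mul_self, hz, ← key]
  refine norm_cfcₙ_le fun t _ => ?_
  have e : (t - t * (t * h t * t)) - (t * h t * t) * (t - t * (t * h t * t)) =
      t * (η ^ 4 / (η ^ 4 + t ^ 4)) ^ 2 := by
    have := (hpos t).ne'
    simp only [hh]
    field_simp
    ring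
  have h1 : η ^ 4 / (η ^ 4 + t ^ 4) ≤ 1 := by
    rw [div_le_one (hpos t)]
    nlinarith [sq_nonneg (t ^ 2)]
  have h2 : |t| * (η ^ 4 / (η ^ 4 + t ^ 4)) ≤ η := by
    rw [mul_div_assoc', div_le_iff₀ (hpos t), ← Even.pow_abs (by decide : Even 4) t]
    have ht := abs_nonneg t
    rcases le_total |t| η with hle | hle
    · nlinarith [mul_le_mul_of_nonneg_right hle (pow_pos hη 4).le, pow_nonneg ht 4]
    · nlinarith [mul_le_mul_of_nonneg_left (pow_le_pow_left₀ hη.le hle 3)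
        (mul_nonneg ht hη.le), pow_pos hη 5]
  have h3 : 0 ≤ η ^ 4 / (η ^ 4 + t ^ 4) := by have := hpos t; positivity
  rw [e, Real.norm_eq_abs, abs_mul, abs_pow, abs_of_nonneg h3]
  calc _ = |t| * (η ^ 4 / (η ^ 4 + t ^ 4)) * (η ^ 4 / (η ^ 4 + t ^ 4)) := by ring
    _ ≤ |t| * (η ^ 4 / (η ^ 4 + t ^ 4)) * 1 := by gcongr
    _ ≤ η := by simpa using h2

theorem mem_closure_range_mul [NonUnitalCStarAlgebra A] (d : A) :
    d ∈ closure (Set.range fun y : A => d * (star d * d * y * (star d * d))) := by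
  refine Metric.mem_closure_range_iff.2 fun ε hε => ?_
  obtain ⟨y, hy⟩ := exists_norm_sub_mul_sq_le d (show 0 < (ε / 2) ^ 2 by positivity)
  refine ⟨y, ?_⟩
  rw [dist_eq_norm]
  have := (sq_le_sq₀ (norm_nonneg _) (by positivity)).1 hy
  linarith

theorem IsClosed.map_mem_of_forall_map_mul_mem [NonUnitalCStarAlgebra A] {S : Set A}
    (hS : IsClosed S) {F : A → A} (hF : Continuous F) {d : A}
    (h : ∀ y, F (d * (star d * d * y * (star d * d))) ∈ S) : F d ∈ S := by
  have := map_mem_closure (t := S) hF (mem_closure_range_mul d) (by rintro _ ⟨y, rfl⟩; exact h y)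
  rwa [hS.closure_eq] at this

theorem TwoSidedIdeal.smul_mem_of_isClosed [NonUnitalCStarAlgebra A] {I : TwoSidedIdeal A}
    (hI : IsClosed (I : Set A)) (c : ℂ) {a : A} (ha : a ∈ I) : c • a ∈ I := by
  refine hI.map_mem_of_forall_map_mul_mem (F := fun z => c • z) (by fun_prop) fun y => ?_
  rw [← mul_smul_comm]
  exact I.mul_mem_right _ _ ha

theorem her_induction [NonUnitalCStarAlgebra A] {x : A} {p : A → Prop}
    (closed : IsClosed {z | p z}) (mem : ∀ y, p (star x * y * x)) (zero : p 0)
    (add : ∀ a b, p a → p b → p (a + b)) (mul : ∀ a b, p a → p b → p (a * b))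
    (smul : ∀ (c : ℂ) a, p a → p (c • a)) {z : A} (hz : z ∈ her x) : p z := by
  let S : NonUnitalSubalgebra ℂ A :=
    { carrier := {z | p z}
      mul_mem' := mul _ _
      add_mem' := add _ _
      zero_mem' := zero
      smul_mem' := smul }
  have hS : NonUnitalAlgebra.adjoin ℂ {z : A | ∃ y : A, z = star x * y * x} ≤ S :=
    NonUnitalAlgebra.adjoin_le (by rintro _ ⟨y, rfl⟩; exact mem y)
  exact NonUnitalSubalgebra.topologicalClosure_minimal hS closed hz

theorem isClosed_her [NonUnitalCStarAlgebra A] (x : A) : IsClosed (her x : Set A) :=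
  NonUnitalSubalgebra.isClosed_topologicalClosure _

theorem star_mul_mul_mem_her [NonUnitalCStarAlgebra A] (x y : A) : star x * y * x ∈ her x :=
  NonUnitalSubalgebra.le_topologicalClosure _ (NonUnitalAlgebra.subset_adjoin ℂ ⟨y, rfl⟩)

theorem star_mem_her [NonUnitalCStarAlgebra A] {x a : A} (ha : a ∈ her x) : star a ∈ her x := by
  refine her_induction (p := fun a => star a ∈ her x) ((isClosed_her x).preimage continuous_star)
    (fun y => ?_) (by simp) (fun a b ha hb => ?_) (fun a b ha hb => ?_) (fun c a ha => ?_) ha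
  · simpa [mul_assoc] using star_mul_mul_mem_her x (star y)
  · simpa using add_mem ha hb
  · simpa using mul_mem hb ha
  · simpa using (her x).smul_mem (star c) ha

theorem mul_mul_mem_her [NonUnitalCStarAlgebra A] {x a b : A} (ha : a ∈ her x) (u : A)
    (hb : b ∈ her x) : a * u * b ∈ her x := by
  have left (y : A) : ∀ u, a * u * (star x * y * x) ∈ her x := by
    refine her_induction (p := fun a => ∀ u, a * u * (star x * y * x) ∈ her x) ?_
      (fun z u => ?_) (by simp) (fun a b ha hb u => ?_) (fun a b ha _ u => ?_)
      (fun c a ha u => ?_) ha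
    · rw [Set.ofPred_forall]
      exact isClosed_iInter fun u => (isClosed_her x).preimage
        (f := fun a => a * u * (star x * y * x)) (by fun_prop)
    · simpa [mul_assoc] using star_mul_mul_mem_her x (z * x * u * star x * y)
    · simpa [add_mul] using add_mem (ha u) (hb u)
    · simpa [mul_assoc] using ha (b * u)
    · simpa [smul_mul_assoc] using (her x).smul_mem c (ha u)
  refine her_induction (p := fun b => ∀ u, a * u * b ∈ her x) ?_
      (fun z u => left z u) (by simp) (fun b c hb hc u => ?_) (fun b c _ hc u => ?_)
      (fun k b hb u => ?_) hb u
  · rw [Set.ofPred_forall]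
    exact isClosed_iInter fun u => (isClosed_her x).preimage
      (f := fun b => a * u * b) (by fun_prop)
  · simpa [mul_add] using add_mem (hb u) (hc u)
  · simpa [mul_assoc] using hc (u * b)
  · simpa [mul_smul_comm] using (her x).smul_mem k (hb u)

theorem TwoSidedIdeal.isClosed_image_val_her [NonUnitalCStarAlgebra A] {x : A}
    {J : TwoSidedIdeal (her x)} (hJ : IsClosed (J : Set (her x))) :
    IsClosed ((↑) '' (J : Set (her x)) : Set A) :=
  (isClosed_her x).isClosedEmbedding_subtypeVal.isClosedMap _ hJ

theorem TwoSidedIdeal.star_mem_of_isClosed_her [NonUnitalCStarAlgebra A] {x : A}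
    {J : TwoSidedIdeal (her x)} (hJ : IsClosed (J : Set (her x))) {a : her x} (ha : a ∈ J) :
    (⟨star (a : A), star_mem_her a.2⟩ : her x) ∈ J := by
  set b : her x := ⟨star (a : A), star_mem_her a.2⟩
  suffices h : (b : A) ∈ ((↑) '' (J : Set (her x)) : Set A) by
    obtain ⟨c, hc, hcb⟩ := h
    rwa [← Subtype.ext hcb]
  refine (isClosed_image_val_her hJ).map_mem_of_forall_map_mul_mem (F := id) continuous_id
    fun y => ?_
  let w : her x := ⟨(b : A) * (y * a) * b, mul_mul_mem_her b.2 _ b.2⟩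
  refine ⟨b * (a * w), J.mul_mem_left _ _ (J.mul_mem_right _ _ ha), ?_⟩
  simp [b, w, mul_assoc]

/-- The closed ideal of `A` extending a closed ideal `J` of the hereditary subalgebra `her x`. -/
def TwoSidedIdeal.extendHer [NonUnitalCStarAlgebra A] {x : A} (J : TwoSidedIdeal (her x)) :
    TwoSidedIdeal A :=
  .mk' {a | ∀ (b c : her x) (u v : A),
      (⟨b * (u * a * v) * c, mul_mul_mem_her b.2 _ c.2⟩ : her x) ∈ J}
    (fun b c u v => by
      convert J.zero_mem
      simp)
    (fun {a a'} ha ha' b c u v => by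
      convert J.add_mem (ha b c u v) (ha' b c u v)
      simp [mul_add, add_mul])
    (fun {a} ha b c u v => by
      convert J.neg_mem (ha b c u v)
      simp)
    (fun {y a} ha b c u v => by
      convert ha b c (u * y) v using 2
      simp only [mul_assoc])
    (fun {a y} ha b c u v => by
      convert ha b c u (y * v) using 2
      simp only [mul_assoc])

theorem TwoSidedIdeal.mem_extendHer [NonUnitalCStarAlgebra A] {x : A} {J : TwoSidedIdeal (her x)}
    {a : A} : a ∈ J.extendHer ↔ ∀ (b c : her x) (u v : A),
      (⟨b * (u * a * v) * c, mul_mul_mem_her b.2 _ c.2⟩ : her x) ∈ J :=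
  mem_mk' ..

theorem TwoSidedIdeal.isClosed_extendHer [NonUnitalCStarAlgebra A] {x : A}
    {J : TwoSidedIdeal (her x)} (hJ : IsClosed (J : Set (her x))) :
    IsClosed (J.extendHer : Set A) := by
  have : (J.extendHer : Set A) = ⋂ (b : her x) (c : her x) (u : A) (v : A),
      (fun a => (⟨b * (u * a * v) * c, mul_mul_mem_her b.2 _ c.2⟩ : her x)) ⁻¹' J := by
    ext a
    simp [mem_extendHer]
  rw [this]
  exact isClosed_iInter fun b => isClosed_iInter fun c => isClosed_iInter fun u =>
    isClosed_iInter fun v => hJ.preimage (by fun_prop)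

theorem TwoSidedIdeal.coe_mem_extendHer_iff [NonUnitalCStarAlgebra A] {x : A}
    {J : TwoSidedIdeal (her x)} (hJ : IsClosed (J : Set (her x))) {a : her x} :
    (a : A) ∈ J.extendHer ↔ a ∈ J := by
  have hS := isClosed_image_val_her hJ
  let s : her x := ⟨star (a : A), star_mem_her a.2⟩
  constructor
  · intro ha
    rw [mem_extendHer] at ha
    suffices h : (a : A) ∈ ((↑) '' (J : Set (her x)) : Set A) by
      obtain ⟨c, hc, hca⟩ := h
      rwa [← Subtype.ext hca]
    refine hS.map_mem_of_forall_map_mul_mem (F := id) continuous_id fun y => ?_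
    refine ⟨_, ha a a (star (a : A)) (y * star (a : A)), ?_⟩
    simp [mul_assoc]
  · intro ha
    rw [mem_extendHer]
    intro b c u v
    have hs : s ∈ J := star_mem_of_isClosed_her hJ ha
    suffices h : (b : A) * (u * a * v) * c ∈ ((↑) '' (J : Set (her x)) : Set A) by
      obtain ⟨d, hd, hdb⟩ := h
      convert (show d ∈ J from hd)
      exact hdb.symm
    refine hS.map_mem_of_forall_map_mul_mem (F := fun z => (b : A) * (u * z * v) * c)
      (by fun_prop) fun y => ?_
    let l : her x := ⟨b * u * a, mul_mul_mem_her b.2 _ a.2⟩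
    let r : her x := ⟨a * (y * star (a : A) * a * v) * c, mul_mul_mem_her a.2 _ c.2⟩
    refine ⟨l * (s * r), J.mul_mem_left _ _ (J.mul_mem_right _ _ hs), ?_⟩
    simp [s, l, r, mul_assoc]

theorem isSoftElem_of_projectionless [NonUnitalCStarAlgebra A]
    (h : ∀ I : TwoSidedIdeal A, IsClosed (I : Set A) →
      ¬ ∃ p : A, p ∉ I ∧ star p - p ∈ I ∧ p * p - p ∈ I) (x : A) : IsSoftElem x := by
  rintro J hJ ⟨w, hw⟩ ⟨e, he⟩
  let f : her x := ⟨star (e : A), star_mem_her e.2⟩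
  refine h J.extendHer (TwoSidedIdeal.isClosed_extendHer hJ) ⟨e, fun hmem => ?_, ?_, ?_⟩
  · rw [TwoSidedIdeal.coe_mem_extendHer_iff hJ] at hmem
    refine hw ?_
    simpa using J.sub_mem (J.mul_mem_left w e hmem) (he w).1
  · have h1 : f * e - f ∈ J := (he f).1
    have h2 : f * e - e ∈ J := by
      convert TwoSidedIdeal.star_mem_of_isClosed_her hJ h1 using 1
      ext
      simp [f]
    have h3 : f - e ∈ J := by simpa using J.sub_mem h2 h1
    simpa [f] using (TwoSidedIdeal.coe_mem_extendHer_iff hJ).2 h3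
  · simpa using (TwoSidedIdeal.coe_mem_extendHer_iff hJ).2 (he e).1

theorem not_exists_projection_of_forall_isSoftElem [NonUnitalCStarAlgebra A]
    (h : ∀ x : A, IsSoftElem x) (I : TwoSidedIdeal A) (hI : IsClosed (I : Set A)) :
    ¬ ∃ p : A, p ∉ I ∧ star p - p ∈ I ∧ p * p - p ∈ I := by
  rintro ⟨p, hp, hs, hpp⟩
  have hsp : star p * p - p ∈ I := by
    convert I.add_mem (I.mul_mem_right _ p hs) hpp using 1
    noncomm_ring
  have hps : p * star p - p ∈ I := by
    convert I.add_mem (I.mul_mem_left p _ hs) hpp using 1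
    noncomm_ring
  have hspp : star p * p * p - p ∈ I := by
    convert I.add_mem (I.mul_mem_right _ p hsp) hpp using 1
    noncomm_ring
  let e : her p := ⟨star p * p * p, star_mul_mul_mem_her p p⟩
  have hr : p * (star p * p * p) - p ∈ I := by
    convert I.add_mem (I.mul_mem_left p _ hspp) hpp using 1
    noncomm_ring
  have hl : star p * p * p * star p - star p ∈ I := by
    convert I.sub_mem (I.add_mem (I.mul_mem_right _ (star p) hspp) hps) hs using 1
    noncomm_ring
  let J : TwoSidedIdeal (her p) := I.comap (NonUnitalSubalgebraClass.subtype (her p))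
  have hmem (z : her p) : z ∈ J ↔ (z : A) ∈ I := TwoSidedIdeal.mem_comap _
  have hJ : IsClosed (J : Set (her p)) := by
    convert hI.preimage (continuous_subtype_val (p := (· ∈ her p))) using 1
    exact Set.ext hmem
  refine h p J hJ ⟨e, fun he => hp ?_⟩ ⟨e, fun z => ?_⟩
  · rw [hmem] at he
    simpa [e] using I.sub_mem he hspp
  · suffices (z : A) * (star p * p * p) - z ∈ I ∧ star p * p * p * (z : A) - z ∈ I by
      simpa [hmem, e] using this
    refine her_induction (p := fun z => z * (star p * p * p) - z ∈ I ∧ star p * p * p * z - z ∈ I)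
      ?_ (fun y => ⟨?_, ?_⟩) (by simp [I.zero_mem]) (fun a b ha hb => ⟨?_, ?_⟩)
      (fun a b ha hb => ⟨?_, ?_⟩) (fun c a ha => ⟨?_, ?_⟩) z.2
    · exact (hI.preimage (f := fun z => z * (star p * p * p) - z) (by fun_prop)).inter
        (hI.preimage (f := fun z => star p * p * p * z - z) (by fun_prop))
    · convert I.mul_mem_left (star p * y) _ hr using 1
      noncomm_ring
    · convert I.mul_mem_right _ (y * p) hl using 1
      noncomm_ring
    · convert I.add_mem ha.1 hb.1 using 1
      noncomm_ring
    · convert I.add_mem ha.2 hb.2 using 1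
      noncomm_ring
    · convert I.mul_mem_left a _ hb.1 using 1
      noncomm_ring
    · convert I.mul_mem_right _ b ha.2 using 1
      noncomm_ring
    · convert TwoSidedIdeal.smul_mem_of_isClosed hI c ha.1 using 1
      rw [smul_sub, smul_mul_assoc]
    · convert TwoSidedIdeal.smul_mem_of_isClosed hI c ha.2 using 1
      rw [smul_sub, mul_smul_comm]

/-- A C*-algebra `A` is projectionless (no quotient of `A` by a closed
two-sided ideal contains a nonzero projection) if and only if every element of `A` is
soft.  (Closed two-sided ideals of a C*-algebra are automatically `*`-invariant, so a
projection in `A/I` is the image of some `p ∈ A` with `p ∉ I`, `star p - p ∈ I` and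
`p * p - p ∈ I`.) -/
theorem projectionless_iff_forall_isSoftElem [NonUnitalCStarAlgebra A] :
    (∀ I : TwoSidedIdeal A, IsClosed (I : Set A) →
        ¬ ∃ p : A, p ∉ I ∧ star p - p ∈ I ∧ p * p - p ∈ I)
      ↔ ∀ x : A, IsSoftElem x :=
  ⟨isSoftElem_of_projectionless, not_exists_projection_of_forall_isSoftElem⟩
end

section
/- Let A be a C*-algebra and let a, b ∈ A₊ satisfy a ◁ b. Then: (1) for every ε > 0 there exists δ > 0 such that (a−ε)₊ ◁ (b−δ)₊; (2) for every ε > 0 there exists c ∈ her(b)₊ such that (a−ε)₊ ◁ c and c ◁ a. -/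
/-!
Common definitions: softness for (non-unital) C*-algebras.

A C*-algebra is *soft* if it has no nonzero unital quotient; equivalently, for every
closed two-sided ideal `I` with `A/I ≠ 0`, the quotient `A/I` is not unital.
We encode properties of the quotient `A/I` intrinsically in `A`.
-/

variable {A : Type*}

/-- The cut-down `(a - ε)₊`, obtained by applying `t ↦ max (t - ε) 0` to `a` via the
(non-unital) continuous functional calculus. -/
noncomputable def cutDown [NonUnitalCStarAlgebra A] [PartialOrder A] [StarOrderedRing A]
    (a : A) (ε : ℝ) : A :=
  cfcₙ (fun t : ℝ => max (t - ε) 0) a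

/-- The closure of an additive subgroup that absorbs multiplication on both sides contains the
closed two-sided ideal generated by each of its elements. -/
theorem Lhd.mem_closure [NonUnitalCStarAlgebra A] {a b : A} (hab : Lhd a b) (S : AddSubgroup A)
    (hl : ∀ x, ∀ w ∈ S, x * w ∈ S) (hr : ∀ x, ∀ w ∈ S, w * x ∈ S)
    (hb : b ∈ closure (S : Set A)) : a ∈ closure (S : Set A) := by
  let T := S.topologicalClosure
  have hTl : ∀ {x y : A}, y ∈ T → x * y ∈ T := fun {x y} hy =>
    map_mem_closure (f := fun w => x * w) (by fun_prop) hy (fun w hw => hl x w hw)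
  have hTr : ∀ {x y : A}, x ∈ T → x * y ∈ T := fun {x y} hx =>
    map_mem_closure (f := fun w => w * y) (by fun_prop) hx (fun w hw => hr y w hw)
  let I : TwoSidedIdeal A := .mk' (T : Set A) T.zero_mem T.add_mem T.neg_mem hTl hTr
  have hI : (I : Set A) = closure (S : Set A) := by
    ext x
    simp [I, T]
  have := hab I (hI ▸ isClosed_closure) (by rw [← SetLike.mem_coe, hI]; exact hb)
  rwa [← SetLike.mem_coe, hI] at this

section Ideal

variable [NonUnitalCStarAlgebra A] [PartialOrder A] [StarOrderedRing A]

theorem mem_of_star_mul_self_le {I : TwoSidedIdeal A} (hI : IsClosed (I : Set A)) {v c : A}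
    (hv : star v * v ≤ c) (hc : c ∈ I) : v ∈ I := by
  have hc0 : 0 ≤ c := (star_mul_self_nonneg v).trans hv
  obtain ⟨y, hy⟩ := CStarAlgebra.nonneg_iff_eq_star_mul_self.mp (sub_nonneg.mpr hv)
  rw [← SetLike.mem_coe, ← hI.closure_eq, Metric.mem_closure_iff]
  intro ε hε
  obtain ⟨η, hη, hηε⟩ : ∃ η : ℝ, 0 < η ∧ η < ε ^ 2 := exists_between (by positivity)
  let h : ℝ → ℝ := fun t => t / (t ^ 2 + η ^ 2)
  have hpos (t : ℝ) : 0 < t ^ 2 + η ^ 2 := by positivity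
  have hcont : Continuous h := by
    unfold h
    exact continuous_id.div (by fun_prop) fun t => (hpos t).ne'
  have h0 : h 0 = 0 := by simp [h]
  have hid : cfcₙ (fun t : ℝ => t) c = c := cfcₙ_id' ℝ c
  let g : A := cfcₙ (fun t : ℝ => t * h t) c
  have hg : g = c * cfcₙ h c := by
    simp only [g]
    rw [cfcₙ_mul (fun t : ℝ => t) h c (by fun_prop) (by simp) (by fun_prop) h0, hid]
  have hgs : star g = g := IsSelfAdjoint.star_eq (cfcₙ_predicate _ c)
  refine ⟨v * g, I.mul_mem_left _ _ (hg ▸ I.mul_mem_right _ _ hc), ?_⟩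
  have hk : c - g * c - c * g + g * c * g =
      cfcₙ (fun t : ℝ => t - t * h t * t - t * (t * h t) + t * h t * t * (t * h t)) c := by
    rw [cfcₙ_add _ _ c (by fun_prop) (by simp) (by fun_prop) (by simp),
      cfcₙ_sub _ _ c (by fun_prop) (by simp) (by fun_prop) (by simp),
      cfcₙ_sub _ _ c (by fun_prop) (by simp) (by fun_prop) (by simp),
      cfcₙ_mul (fun t => t * h t * t) (fun t => t * h t) c (by fun_prop) (by simp)
        (by fun_prop) (by simp),
      cfcₙ_mul (fun t => t * h t) (fun t => t) c (by fun_prop) (by simp) (by fun_prop) (by simp),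
      cfcₙ_mul (fun t => t) (fun t => t * h t) c (by fun_prop) (by simp) (by fun_prop) (by simp),
      hid]
  have hkn : ‖c - g * c - c * g + g * c * g‖ ≤ η := by
    rw [hk]
    refine norm_cfcₙ_le fun t _ => ?_
    have hp := hpos t
    have : t - t * h t * t - t * (t * h t) + t * h t * t * (t * h t)
        = t * η ^ 4 / (t ^ 2 + η ^ 2) ^ 2 := by
      simp only [h]
      field_simp
      ring
    rw [this, Real.norm_eq_abs, abs_div, abs_of_pos (pow_pos hp 2), div_le_iff₀ (pow_pos hp 2),
      abs_mul, abs_of_pos (pow_pos hη 4), ← sq_abs t]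
    have h1 : |t| * η ≤ |t| ^ 2 + η ^ 2 := by nlinarith [sq_nonneg (|t| - η), sq_nonneg (|t|)]
    have h2 : η ^ 2 ≤ |t| ^ 2 + η ^ 2 := by nlinarith [sq_nonneg (|t|)]
    calc |t| * η ^ 4 = η * ((|t| * η) * η ^ 2) := by ring
      _ ≤ η * ((|t| ^ 2 + η ^ 2) * (|t| ^ 2 + η ^ 2)) := by gcongr
      _ = η * (|t| ^ 2 + η ^ 2) ^ 2 := by ring
  have hle : star (v - v * g) * (v - v * g) ≤ c - g * c - c * g + g * c * g := by
    rw [← sub_nonneg]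
    convert star_mul_self_nonneg (y - y * g) using 1
    have hcy : c = star v * v + star y * y := by rw [← hy]; abel
    simp only [star_sub, star_mul, hgs]
    rw [hcy]
    noncomm_ring
  have hn := (CStarAlgebra.norm_le_norm_of_nonneg_of_le (star_mul_self_nonneg _) hle).trans hkn
  rw [CStarRing.norm_star_mul_self] at hn
  rw [dist_eq_norm]
  exact lt_of_pow_lt_pow_left₀ 2 hε.le (by nlinarith)

theorem mem_of_nonneg_of_le {I : TwoSidedIdeal A} (hI : IsClosed (I : Set A)) {d c : A}
    (hd : 0 ≤ d) (hdc : d ≤ c) (hc : c ∈ I) : d ∈ I := by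
  obtain ⟨y, rfl⟩ := CStarAlgebra.nonneg_iff_eq_star_mul_self.mp hd
  exact I.mul_mem_left _ _ (mem_of_star_mul_self_le hI hdc hc)

theorem cutDown_mem_of_norm_sub_lt {I : TwoSidedIdeal A} (hI : IsClosed (I : Set A)) {a z : A}
    (ha : 0 ≤ a) {ε : ℝ} (hε : 0 < ε) (hz : z ∈ I) (haz : ‖a * a - z‖ < ε ^ 2) :
    cutDown a ε ∈ I := by
  let f : ℕ → ℝ → ℝ := fun n t => max (t - ε) 0 / max t ε ^ (2 * n)
  have hpos (t : ℝ) : 0 < max t ε := lt_max_of_lt_right hε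
  have hcont (n : ℕ) : Continuous (f n) := by
    unfold f
    exact (by fun_prop : Continuous fun t : ℝ => max (t - ε) 0).div (by fun_prop)
      fun t => (pow_pos (hpos t) _).ne'
  have h0 (n : ℕ) : f n 0 = 0 := by simp [f, hε.le]
  let p : ℕ → A := fun n => cfcₙ (f n) a
  have hid : cfcₙ (fun t : ℝ => t) a = a := cfcₙ_id' ℝ a
  have hp0 : p 0 = cutDown a ε := by simp [p, f, cutDown]
  have hps (n : ℕ) : p n = a * a * p (n + 1) := by
    have : f n = fun t => t * t * f (n + 1) t := by
      funext t
      simp only [f]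
      rcases le_total t ε with h | h
      · simp [h]
      · rw [max_eq_left h]
        have : t ≠ 0 := (hε.trans_le h).ne'
        field_simp
        ring
    simp only [p]
    rw [this, cfcₙ_mul (fun t : ℝ => t * t) (f (n + 1)) a (by fun_prop) (by simp)
      (hcont _).continuousOn (h0 _), cfcₙ_mul (fun t : ℝ => t) (fun t => t) a, hid]
  have hpn (n : ℕ) : ‖p n‖ ≤ ‖a‖ / (ε ^ 2) ^ n := by
    refine norm_cfcₙ_le fun t ht => ?_
    have ht0 : 0 ≤ t := quasispectrum_nonneg_of_nonneg a ha t ht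
    have hta : t ≤ ‖a‖ := (le_abs_self t).trans (by
      simpa [hid] using norm_apply_le_norm_cfcₙ (fun t : ℝ => t) a ht)
    rw [Real.norm_of_nonneg (div_nonneg (le_max_right _ _) (pow_pos (hpos t) _).le), ← pow_mul]
    apply div_le_div₀ (norm_nonneg a) (max_le (by linarith) (norm_nonneg a)) (by positivity)
    exact pow_le_pow_left₀ hε.le (le_max_right _ _) _
  set d := a * a - z with hd
  have key (n : ℕ) : ∃ w, p 0 - w ∈ I ∧ ‖w‖ ≤ ‖a‖ * (‖d‖ / ε ^ 2) ^ n := by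
    suffices ∀ m, ∃ w, p m - w ∈ I ∧ ‖w‖ ≤ ‖d‖ ^ n * ‖p (m + n)‖ by
      obtain ⟨w, hw, hwn⟩ := this 0
      refine ⟨w, hw, hwn.trans ?_⟩
      rw [zero_add, div_pow, mul_div_left_comm]
      gcongr
      exact hpn n
    induction n with
    | zero => exact fun m => ⟨p m, by simp [I.zero_mem], by simp⟩
    | succ n ih =>
      intro m
      obtain ⟨w, hw, hwn⟩ := ih (m + 1)
      refine ⟨d * w, ?_, ?_⟩
      · have : p m - d * w = z * p (m + 1) + d * (p (m + 1) - w) := by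
          rw [hps m, mul_sub, ← add_sub_assoc, ← add_mul, hd, add_sub_cancel]
        rw [this]
        exact I.add_mem (I.mul_mem_right _ _ hz) (I.mul_mem_left _ _ hw)
      · rw [pow_succ', mul_assoc, show m + (n + 1) = m + 1 + n by ring]
        exact (norm_mul_le _ _).trans (by gcongr)
  rw [← hp0]
  choose w hw hwn using key
  have hlim : Filter.Tendsto (fun n => p 0 - w n) Filter.atTop (nhds (p 0 - 0)) := by
    refine tendsto_const_nhds.sub (squeeze_zero_norm hwn ?_)
    simpa using (tendsto_pow_atTop_nhds_zero_of_lt_one (by positivity)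
      ((div_lt_one (by positivity)).mpr haz)).const_mul ‖a‖
  rw [sub_zero] at hlim
  exact hI.mem_of_tendsto hlim (.of_forall hw)

theorem cutDown_mem_of_norm_sub_lt_div {I : TwoSidedIdeal A} (hI : IsClosed (I : Set A)) {a w : A}
    (ha : 0 ≤ a) {ε : ℝ} (hε : 0 < ε) (hw : a * w ∈ I) (haw : ‖a - w‖ < ε ^ 2 / (‖a‖ + 1)) :
    cutDown a ε ∈ I := by
  refine cutDown_mem_of_norm_sub_lt hI ha hε hw ?_
  rw [lt_div_iff₀ (by positivity)] at haw
  rw [← mul_sub]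
  refine (norm_mul_le _ _).trans_lt ?_
  nlinarith [norm_nonneg (a - w)]

theorem cutDown_nonneg (b : A) (δ : ℝ) : 0 ≤ cutDown b δ :=
  cfcₙ_nonneg fun _ _ => le_max_right _ _

theorem cutDown_anti (b : A) {δ δ' : ℝ} (hδ : 0 < δ) (h : δ ≤ δ') :
    cutDown b δ' ≤ cutDown b δ :=
  cfcₙ_mono (fun t _ => max_le_max (by linarith) le_rfl) (by fun_prop) (by fun_prop)
    (by simp [hδ.le.trans h]) (by simp [hδ.le])

theorem norm_sub_cutDown_le {b : A} (hb : 0 ≤ b) {δ : ℝ} (hδ : 0 < δ) :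
    ‖b - cutDown b δ‖ ≤ δ := by
  have : b - cutDown b δ = cfcₙ (fun t : ℝ => t - max (t - δ) 0) b := by
    rw [cfcₙ_sub (fun t : ℝ => t) _ b (by fun_prop) (by simp) (by fun_prop) (by simp [hδ.le]),
      cfcₙ_id' ℝ b, cutDown]
  rw [this]
  refine norm_cfcₙ_le fun t ht => ?_
  have ht0 : 0 ≤ t := quasispectrum_nonneg_of_nonneg b hb t ht
  rw [Real.norm_eq_abs, abs_le]
  rcases le_total t δ with h | h
  · rw [max_eq_right (by linarith)]
    constructor <;> linarith
  · rw [max_eq_left (by linarith)]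
    constructor <;> linarith

/-- Every cut-down of an element of the closed ideal generated by `b` lies in the closed ideal
generated by some cut-down of `b`. -/
theorem exists_lhd_cutDown {a b : A} (ha : 0 ≤ a) (hb : 0 ≤ b) (hab : Lhd a b) {ε : ℝ}
    (hε : 0 < ε) : ∃ δ : ℝ, 0 < δ ∧ Lhd (cutDown a ε) (cutDown b δ) := by
  let S : AddSubgroup A :=
    { carrier := {w | ∃ δ : ℝ, 0 < δ ∧ Lhd w (cutDown b δ)}
      zero_mem' := ⟨1, one_pos, fun I _ _ => I.zero_mem⟩
      add_mem' := by
        rintro v w ⟨δ, hδ, hv⟩ ⟨η, hη, hw⟩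
        have hm : 0 < min δ η := lt_min hδ hη
        refine ⟨min δ η, hm, fun I hI h => I.add_mem (hv I hI ?_) (hw I hI ?_)⟩
        · exact mem_of_nonneg_of_le hI (cutDown_nonneg b δ) (cutDown_anti b hm (min_le_left _ _)) h
        · exact mem_of_nonneg_of_le hI (cutDown_nonneg b η) (cutDown_anti b hm (min_le_right _ _)) h
      neg_mem' := by
        rintro v ⟨δ, hδ, hv⟩
        exact ⟨δ, hδ, fun I hI h => I.neg_mem (hv I hI h)⟩ }
  have hbS : b ∈ closure (S : Set A) := by
    rw [Metric.mem_closure_iff]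
    intro r hr
    refine ⟨cutDown b (r / 2), ⟨r / 2, half_pos hr, fun I _ h => h⟩, ?_⟩
    rw [dist_eq_norm]
    exact (norm_sub_cutDown_le hb (half_pos hr)).trans_lt (half_lt_self hr)
  have haS := hab.mem_closure S
    (fun x w ⟨δ, hδ, hw⟩ => ⟨δ, hδ, fun I hI h => I.mul_mem_left _ _ (hw I hI h)⟩)
    (fun x w ⟨δ, hδ, hw⟩ => ⟨δ, hδ, fun I hI h => I.mul_mem_right _ _ (hw I hI h)⟩) hbS
  obtain ⟨w, ⟨δ, hδ, hw⟩, haw⟩ :=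
    Metric.mem_closure_iff.mp haS (ε ^ 2 / (‖a‖ + 1)) (by positivity)
  rw [dist_eq_norm] at haw
  exact ⟨δ, hδ, fun I hI h =>
    cutDown_mem_of_norm_sub_lt_div hI ha hε (I.mul_mem_left _ _ (hw I hI h)) haw⟩

/-- Every cut-down of an element `a` of the closed ideal generated by `b` lies in the closed ideal
generated by a positive element of `her b` that itself lies in the closed ideal generated
by `a`. -/
theorem exists_mem_her_lhd {a b : A} (ha : 0 ≤ a) (hab : Lhd a b) {ε : ℝ} (hε : 0 < ε) :
    ∃ c : A, c ∈ her b ∧ 0 ≤ c ∧ Lhd (cutDown a ε) c ∧ Lhd c a := by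
  let S : AddSubgroup A :=
    { carrier := {w | ∀ x, Lhd x a → ∃ c ∈ her b, 0 ≤ c ∧ Lhd c a ∧ Lhd (x * w) c}
      zero_mem' := fun x _ => ⟨0, zero_mem _, le_rfl, fun I _ _ => I.zero_mem,
        fun I _ _ => by rw [mul_zero]; exact I.zero_mem⟩
      add_mem' := by
        intro v w hv hw x hx
        obtain ⟨c, hcb, hc, hca, hcv⟩ := hv x hx
        obtain ⟨d, hdb, hd, hda, hdw⟩ := hw x hx
        refine ⟨c + d, add_mem hcb hdb, add_nonneg hc hd,
          fun I hI h => I.add_mem (hca I hI h) (hda I hI h), fun I hI h => ?_⟩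
        rw [mul_add]
        exact I.add_mem (hcv I hI (mem_of_nonneg_of_le hI hc (le_add_of_nonneg_right hd) h))
          (hdw I hI (mem_of_nonneg_of_le hI hd (le_add_of_nonneg_left hc) h))
      neg_mem' := by
        intro v hv x hx
        obtain ⟨c, hcb, hc, hca, hcv⟩ := hv x hx
        exact ⟨c, hcb, hc, hca, fun I hI h => by rw [mul_neg]; exact I.neg_mem (hcv I hI h)⟩ }
  have hbS : b ∈ S := by
    intro x hx
    refine ⟨star (x * b) * (x * b), ?_, star_mul_self_nonneg _,
      fun I hI h => I.mul_mem_left _ _ (I.mul_mem_right _ _ (hx I hI h)),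
      fun I hI h => mem_of_star_mul_self_le hI le_rfl h⟩
    refine NonUnitalSubalgebra.le_topologicalClosure _ (NonUnitalAlgebra.subset_adjoin ℂ ?_)
    exact ⟨star x * x, by simp only [star_mul, mul_assoc]⟩
  have haS := hab.mem_closure S
    (fun y w hw x hx => by
      rw [← mul_assoc]
      exact hw (x * y) fun I hI h => I.mul_mem_right _ _ (hx I hI h))
    (fun y w hw x hx => by
      obtain ⟨c, hcb, hc, hca, hcw⟩ := hw x hx
      refine ⟨c, hcb, hc, hca, fun I hI h => ?_⟩
      rw [← mul_assoc]
      exact I.mul_mem_right _ _ (hcw I hI h))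
    (subset_closure hbS)
  obtain ⟨w, hw, haw⟩ := Metric.mem_closure_iff.mp haS (ε ^ 2 / (‖a‖ + 1)) (by positivity)
  rw [dist_eq_norm] at haw
  obtain ⟨c, hcb, hc, hca, hcw⟩ := hw a fun _ _ h => h
  exact ⟨c, hcb, hc, fun I hI h => cutDown_mem_of_norm_sub_lt_div hI ha hε (hcw I hI h) haw, hca⟩

end Ideal

/-- Let `a, b ∈ A₊` satisfy `a ◁ b`.  Then (1) for every `ε > 0`
there is `δ > 0` with `(a-ε)₊ ◁ (b-δ)₊`; and (2) for every `ε > 0` there is a positive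
`c ∈ her b` with `(a-ε)₊ ◁ c` and `c ◁ a`. -/
theorem basic_lhd_properties [NonUnitalCStarAlgebra A] [PartialOrder A] [StarOrderedRing A]
    (a b : A) (ha : 0 ≤ a) (hb : 0 ≤ b) (hab : Lhd a b) :
    (∀ ε : ℝ, 0 < ε → ∃ δ : ℝ, 0 < δ ∧ Lhd (cutDown a ε) (cutDown b δ))
    ∧ (∀ ε : ℝ, 0 < ε →
        ∃ c : A, c ∈ her b ∧ 0 ≤ c ∧ Lhd (cutDown a ε) c ∧ Lhd c a) :=
  ⟨fun _ hε => exists_lhd_cutDown ha hb hab hε, fun _ hε => exists_mem_her_lhd ha hab hε⟩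
end
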